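/- Let p and q be positive integers and let G be a graph with tw(G) ≥ 20p^2q^2 − 8p^2q + 2q − 1 and contraction degeneracy degec(G) < 2pq. Then there exist 2p pairwise disjoint sets Y_1, Z_1, …, Y_p, Z_p ⊆ V(G), each of size q, a set A ⊆ V(G), pairwise vertex-disjoint trees (subgraphs of G with vertices in A) connecting each of these 2p sets, and a collection P of pq pairwise vertex-disjoint paths of G, each of length at least 2, such that for each i ∈ {1, …, p} exactly q of the paths of P have one end in Y_i and the other end in Z_i, and no internal vertex of any path of P lies in A or in any of the 2p sets. -/

import Mathlib

open SimpleGraph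

/-- A minor model of `H` in `G`: pairwise disjoint branch sets `B v ⊆ V(G)`, each
inducing a connected (hence nonempty) subgraph of `G`, such that for every edge
`{u,v}` of `H` there is an edge of `G` between `B u` and `B v`. -/
def IsMinorModel {β α : Type*} (H : SimpleGraph β) (G : SimpleGraph α)
    (B : β → Set α) : Prop :=
  (∀ u, (G.induce (B u)).Connected) ∧
  (Pairwise fun u v => Disjoint (B u) (B v)) ∧
  (∀ u v, H.Adj u v → ∃ a ∈ B u, ∃ b ∈ B v, G.Adj a b)

/-- `H` is a minor of `G`. -/
def IsMinor {β α : Type*} (H : SimpleGraph β) (G : SimpleGraph α) : Prop :=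
  ∃ B : β → Set α, IsMinorModel H G B

/-- `G` contains `k` models of `H` whose vertex sets are pairwise disjoint
(equivalently, the disjoint union of `k` copies of `H` is a minor of `G`). -/
def HasDisjointModels {β α : Type*} (H : SimpleGraph β) (G : SimpleGraph α) (k : ℕ) : Prop :=
  ∃ M : Fin k → β → Set α, (∀ i, IsMinorModel H G (M i)) ∧
    Pairwise fun i j => Disjoint (⋃ u, M i u) (⋃ u, M j u)

/-- `pack_H(G)`: the maximum number of pairwise disjoint models of `H` in `G`. -/
noncomputable def packNumber {β α : Type*} (H : SimpleGraph β) (G : SimpleGraph α) : ℕ :=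
  sSup {k | HasDisjointModels H G k}

/-- `S` meets every model of `H` in `G`. -/
def IsHittingSet {β α : Type*} (H : SimpleGraph β) (G : SimpleGraph α) (S : Set α) : Prop :=
  ∀ B : β → Set α, IsMinorModel H G B → ∃ a ∈ S, ∃ u, a ∈ B u

/-- `cover_H(G)`: the minimum size of a set of vertices meeting every model of `H` in `G`. -/
noncomputable def coverNumber {β α : Type*} (H : SimpleGraph β) (G : SimpleGraph α) : ℕ :=
  sInf {n | ∃ S : Set α, IsHittingSet H G S ∧ S.ncard = n}

/-- A tree/path decomposition of `G` with underlying graph `T` and bags `X`. -/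
def IsTreeDecomp {α ι : Type*} (G : SimpleGraph α) (T : SimpleGraph ι) (X : ι → Set α) : Prop :=
  (∀ v, ∃ t, v ∈ X t) ∧
  (∀ u v, G.Adj u v → ∃ t, u ∈ X t ∧ v ∈ X t) ∧
  (∀ v, (T.induce {t | v ∈ X t}).Connected)

/-- The treewidth of `G`: the minimum width of a tree decomposition of `G`. -/
noncomputable def treewidth {α : Type*} (G : SimpleGraph α) : ℕ :=
  sInf {w | ∃ (ι : Type) (T : SimpleGraph ι) (X : ι → Set α),
    T.IsTree ∧ IsTreeDecomp G T X ∧ ∀ t, (X t).ncard ≤ w + 1}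

/-- The pathwidth of `G`: the minimum width of a tree decomposition whose
underlying tree is a path. -/
noncomputable def pathwidth {α : Type*} (G : SimpleGraph α) : ℕ :=
  sInf {w | ∃ (n : ℕ) (X : Fin (n+1) → Set α),
    IsTreeDecomp G (pathGraph (n+1)) X ∧ ∀ t, (X t).ncard ≤ w + 1}

/-- The degeneracy of `G`: the maximum over all (nonempty) subgraphs of `G`
of the minimum degree. -/
noncomputable def degeneracy {α : Type*} (G : SimpleGraph α) : ℕ :=
  sSup {d | ∃ G' : G.Subgraph, G'.verts.Nonempty ∧ ∀ v ∈ G'.verts, d ≤ (G'.neighborSet v).ncard}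

/-- The contraction degeneracy of `G`: the maximum over all (nonempty) minors of `G`
of the minimum degree. -/
noncomputable def contractionDegeneracy {α : Type*} (G : SimpleGraph α) : ℕ :=
  sSup {d | ∃ (n : ℕ) (H : SimpleGraph (Fin n)), 0 < n ∧ IsMinor H G ∧
    ∀ v, d ≤ (H.neighborSet v).ncard}


/-- `X` and `Y` are externally `q`-connected within the vertex set `W` of `G`:
for all disjoint `X' ⊆ X`, `Y' ⊆ Y` with `|X'| = |Y'| ≤ q` there are `|X'|`
pairwise disjoint `X'`–`Y'` paths (inside `W`) having no internal vertices and
no edges in `G[X ∪ Y]`. -/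
def ExternallyConnectedIn {α : Type*} (G : SimpleGraph α) (W X Y : Set α) (q : ℕ) : Prop :=
  ∀ X' Y' : Finset α, ↑X' ⊆ X → ↑Y' ⊆ Y → Disjoint (X' : Set α) (Y' : Set α) →
    X'.card = Y'.card → X'.card ≤ q →
    ∃ p : (x : X') → Σ y : Y', G.Walk x.1 y.1,
      (∀ x, (p x).2.IsPath) ∧
      (∀ x, ∀ v ∈ (p x).2.support, v ∈ W) ∧
      (Pairwise fun x₁ x₂ => ∀ v, v ∈ (p x₁).2.support → v ∉ (p x₂).2.support) ∧
      (∀ x, ∀ v ∈ (p x).2.support.tail.dropLast, v ∉ X ∪ Y) ∧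
      (∀ x, ∀ u v : α, s(u, v) ∈ (p x).2.edges → ¬(u ∈ X ∪ Y ∧ v ∈ X ∪ Y))

/-- `(A, B)` is a `q`-mesh of order `s` in `G`. -/
def IsMesh {α : Type*} (G : SimpleGraph α) (A B : Set α) (q s : ℕ) : Prop :=
  A ∪ B = Set.univ ∧
  ∃ T : G.Subgraph, T.verts ⊆ A ∧ T.coe.IsTree ∧
    (∀ v ∈ T.verts, (T.neighborSet v).ncard ≤ 3) ∧
    A ∩ B ⊆ T.verts ∧
    (∀ v ∈ A ∩ B, (T.neighborSet v).ncard ≤ 2) ∧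
    (∃ v ∈ A ∩ B, (T.neighborSet v).ncard = 1) ∧
    (A ∩ B).ncard = s ∧
    ExternallyConnectedIn G B (A ∩ B) (A ∩ B) q

/-- The graph `Ξ_r`, with vertices `x_i = (0,i)`, `y_i = (1,i)`, `z_i = (2,i)`. -/
def Xi (r : ℕ) : SimpleGraph (Fin 3 × Fin r) :=
  SimpleGraph.fromRel (fun a b =>
    (a.1 = 0 ∧ b.1 = 0 ∧ (b.2 : ℕ) = (a.2 : ℕ) + 1) ∨
    (a.1 = 2 ∧ b.1 = 2 ∧ (b.2 : ℕ) = (a.2 : ℕ) + 1) ∨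
    (a.1 = 1 ∧ a.2 = b.2 ∧ (b.1 = 0 ∨ b.1 = 2)))

/-- The underlying simple bipartite graph of the bipartite multigraph with
parts `α`, `β` and multiplicity function `m`. -/
def bipMulti {α β : Type*} (m : α → β → ℕ) : SimpleGraph (α ⊕ β) :=
  SimpleGraph.fromRel (fun x y => match x, y with
    | Sum.inl v, Sum.inr u => 1 ≤ m v u
    | _, _ => False)

/-- `u` and `v` are joined by a walk of `G` all of whose vertices lie in `S`. -/
def JoinedWithin {α : Type*} (G : SimpleGraph α) (S : Set α) (u v : α) : Prop :=
  ∃ w : G.Walk u v, ∀ x ∈ w.support, x ∈ S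

namespace JoinedWithin

variable {α : Type*} {G H : SimpleGraph α} {S T : Set α} {u v x y : α}

theorem refl (hu : u ∈ S) : JoinedWithin G S u u := ⟨.nil, by simpa using hu⟩

theorem of_eq (h : u = v) (hu : u ∈ S) : JoinedWithin G S u v := h ▸ refl hu

theorem symm (h : JoinedWithin G S u v) : JoinedWithin G S v u := by
  obtain ⟨w, hw⟩ := h
  exact ⟨w.reverse, by simpa using hw⟩

theorem trans (h : JoinedWithin G S u v) (h' : JoinedWithin G S v x) : JoinedWithin G S u x := by
  obtain ⟨w, hw⟩ := h
  obtain ⟨w', hw'⟩ := h'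
  refine ⟨w.append w', fun z hz => ?_⟩
  rw [Walk.mem_support_append_iff] at hz
  exact hz.elim (hw z) (hw' z)

theorem of_adj (h : G.Adj u v) (hu : u ∈ S) (hv : v ∈ S) : JoinedWithin G S u v :=
  ⟨.cons h .nil, by simp [hu, hv]⟩

theorem mono (h : JoinedWithin G S u v) (hG : G ≤ H) (hS : S ⊆ T) : JoinedWithin H T u v := by
  obtain ⟨w, hw⟩ := h
  exact ⟨w.mapLe hG, by simpa using fun z hz => hS (hw z hz)⟩

theorem left_mem (h : JoinedWithin G S u v) : u ∈ S := by
  obtain ⟨w, hw⟩ := h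
  exact hw _ w.start_mem_support

theorem right_mem (h : JoinedWithin G S u v) : v ∈ S := h.symm.left_mem

theorem of_mem_support (w : G.Walk u v) (hw : ∀ z ∈ w.support, z ∈ S) (hx : x ∈ w.support) :
    JoinedWithin G S u x := by
  classical
  exact ⟨w.takeUntil x hx, fun z hz => hw z (w.support_takeUntil_subset_support hx hz)⟩

/-- Either the walk stays in `T` or it reaches a vertex outside `T`. -/
theorem inter_or_exists_notMem (h : JoinedWithin G S u v) (T : Set α) :
    JoinedWithin G T u v ∨ ∃ z, z ∉ T ∧ JoinedWithin G S u z := by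
  obtain ⟨w, hw⟩ := h
  by_cases hT : ∀ z ∈ w.support, z ∈ T
  · exact .inl ⟨w, hT⟩
  · push Not at hT
    obtain ⟨z, hz, hzT⟩ := hT
    exact .inr ⟨z, hzT, of_mem_support w hw hz⟩

/-- Every walk either avoids the edge `s(x, y)` or has a first and a last passage through it. -/
theorem deleteEdge_cases (h : JoinedWithin G S u v) (x y : α) :
    JoinedWithin (G.deleteEdges {s(x, y)}) S u v ∨
    (JoinedWithin (G.deleteEdges {s(x, y)}) S u x ∧
      JoinedWithin (G.deleteEdges {s(x, y)}) S y v) ∨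
    (JoinedWithin (G.deleteEdges {s(x, y)}) S u y ∧
      JoinedWithin (G.deleteEdges {s(x, y)}) S x v) := by
  obtain ⟨w, hw⟩ := h
  induction w with
  | nil => exact .inl (refl (hw _ (by simp)))
  | @cons a c b hac p ih =>
    have ha : a ∈ S := hw _ (by simp)
    have hc : c ∈ S := hw _ (by simp)
    have ih := ih fun z hz => hw z (by simp [hz])
    by_cases he : s(a, c) = s(x, y)
    · rcases Sym2.eq_iff.1 he with ⟨rfl, rfl⟩ | ⟨rfl, rfl⟩
      · rcases ih with h | ⟨_, h⟩ | ⟨_, h⟩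
        · exact .inr (.inl ⟨refl ha, h⟩)
        · exact .inr (.inl ⟨refl ha, h⟩)
        · exact .inl h
      · rcases ih with h | ⟨_, h⟩ | ⟨_, h⟩
        · exact .inr (.inr ⟨refl ha, h⟩)
        · exact .inl h
        · exact .inr (.inr ⟨refl ha, h⟩)
    · have hac' : JoinedWithin (G.deleteEdges {s(x, y)}) S a c :=
        of_adj (by simp [deleteEdges_adj, hac, he]) ha hc
      rcases ih with h | ⟨h, h'⟩ | ⟨h, h'⟩
      · exact .inl (hac'.trans h)
      · exact .inr (.inl ⟨hac'.trans h, h'⟩)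
      · exact .inr (.inr ⟨hac'.trans h, h'⟩)

end JoinedWithin

/-- `S` meets every walk of `G` from `A` to `B`. -/
def Separates {α : Type*} (G : SimpleGraph α) (A B S : Set α) : Prop :=
  ∀ a ∈ A, ∀ b ∈ B, ¬ JoinedWithin G Sᶜ a b

/-- `G` contains `k` pairwise disjoint walks from `A` to `B`. -/
def Linked {α : Type*} (G : SimpleGraph α) (A B : Set α) (k : ℕ) : Prop :=
  ∃ (a b : Fin k → α) (w : ∀ i, G.Walk (a i) (b i)),
    (∀ i, a i ∈ A) ∧ (∀ i, b i ∈ B) ∧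
    ∀ i j, i ≠ j → ∀ v, v ∈ (w i).support → v ∉ (w j).support

section Menger

variable {α : Type*} {G : SimpleGraph α} {A B S : Set α} {k : ℕ}

theorem Separates.symm (h : Separates G A B S) : Separates G B A S :=
  fun b hb a ha hj => h a ha b hb hj.symm

theorem Linked.mono {H : SimpleGraph α} (h : Linked G A B k) (hG : G ≤ H) : Linked H A B k := by
  obtain ⟨a, b, w, ha, hb, hd⟩ := h
  exact ⟨a, b, fun i => (w i).mapLe hG, ha, hb, by simpa using hd⟩

/-- If `S` separates `A` from `B` in `G - xy`, then a set separating `A` from `S ∪ {x}` in `G - xy`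
separates `A` from `B` in `G`, provided `y` can be joined to `B` in `G - xy` avoiding `S`. -/
theorem Separates.of_deleteEdge {x y : α} {R : Set α}
    (hS : Separates (G.deleteEdges {s(x, y)}) A B S)
    {b₀ : α} (hb₀ : b₀ ∈ B) (hy : JoinedWithin (G.deleteEdges {s(x, y)}) Sᶜ y b₀)
    (hR : Separates (G.deleteEdges {s(x, y)}) A (insert x S) R) : Separates G A B R := by
  intro a ha b hb hab
  have hS' : ∀ s ∈ S, ¬ JoinedWithin (G.deleteEdges {s(x, y)}) Rᶜ a s :=
    fun s hs => hR a ha s (Set.mem_insert_of_mem _ hs)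
  rcases hab.deleteEdge_cases x y with h | ⟨h, -⟩ | ⟨h, -⟩
  · rcases h.inter_or_exists_notMem Sᶜ with h | ⟨z, hz, h⟩
    · exact hS a ha b hb h
    · exact hS' z (by simpa using hz) h
  · exact hR a ha x (Set.mem_insert _ _) h
  · rcases h.inter_or_exists_notMem Sᶜ with h | ⟨z, hz, h⟩
    · exact hS a ha b₀ hb₀ (h.trans hy)
    · exact hS' z (by simpa using hz) h

/-- A linkage onto a set of its own size: its end vertices exhaust the set, and each of its walks
can be chosen to meet the set only in its end vertex. -/
theorem Linked.exists_trimmed [Finite α] (h : Linked G A S k) (hk : S.ncard ≤ k) :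
    ∃ (a b : Fin k → α) (w : ∀ i, G.Walk (a i) (b i)),
      (∀ i, a i ∈ A) ∧ (∀ i, b i ∈ S) ∧
      (∀ i j, i ≠ j → ∀ v, v ∈ (w i).support → v ∉ (w j).support) ∧
      Function.Injective b ∧ (∀ s ∈ S, ∃ i, b i = s) ∧
      ∀ i, ∀ v ∈ (w i).support, v = b i ∨ JoinedWithin G Sᶜ (a i) v := by
  classical
  obtain ⟨a, b, w, ha, hb, hd⟩ := h
  have hinj : Function.Injective b := by
    intro i j hij
    by_contra hne
    refine hd i j hne (b i) (w i).end_mem_support ?_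
    rw [hij]
    exact (w j).end_mem_support
  have hsurj : ∀ s ∈ S, ∃ i, b i = s := by
    have hr : Set.range b = S := by
      refine Set.eq_of_subset_of_ncard_le (by rintro _ ⟨i, rfl⟩; exact hb i) ?_ (Set.toFinite _)
      rw [← Set.image_univ, Set.ncard_image_of_injective _ hinj, Set.ncard_univ]
      simpa using hk
    intro s hs
    rw [← hr] at hs
    exact hs
  refine ⟨a, b, fun i => (w i).bypass, ha, hb, ?_, hinj, hsurj, ?_⟩
  · intro i j hij v hv hv'
    exact hd i j hij v ((w i).support_bypass_subset_support hv) ((w j).support_bypass_subset_support hv')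
  · intro i v hv
    by_cases hvb : v = b i
    · exact .inl hvb
    refine .inr ⟨(w i).bypass.takeUntil v hv, fun z hz hzS => ?_⟩
    obtain ⟨j, rfl⟩ := hsurj z hzS
    have hz' := (w i).support_bypass_subset_support ((w i).bypass.support_takeUntil_subset_support hv hz)
    by_cases hij : i = j
    · subst hij
      exact Walk.endpoint_notMem_support_takeUntil (w i).bypass_isPath hv (Ne.symm hvb) hz
    · exact hd i j hij _ hz' (w j).end_mem_support

/-- Menger's theorem for finite graphs. -/
theorem menger [Finite α] (G : SimpleGraph α) (A B : Set α) (k : ℕ)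
    (h : ∀ S, Separates G A B S → k ≤ S.ncard) : Linked G A B k := by
  classical
  induction hn : G.edgeSet.ncard using Nat.strong_induction_on generalizing G A B with
  | _ n ih =>
  by_cases hE : ∃ x y, G.Adj x y
  swap
  · have hAB : k ≤ (A ∩ B).ncard := by
      refine h _ fun a ha b hb ⟨w, hw⟩ => ?_
      cases w with
      | nil => exact hw a (by simp) ⟨ha, hb⟩
      | cons hac p => exact hE ⟨_, _, hac⟩
    obtain ⟨f⟩ : Nonempty (Fin k ↪ (A ∩ B : Set α)) := by
      have := Fintype.ofFinite (A ∩ B : Set α)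
      refine Function.Embedding.nonempty_of_card_le ?_
      rw [Fintype.card_fin, ← Nat.card_eq_fintype_card]
      exact hAB
    refine ⟨fun i => f i, fun i => f i, fun i => .nil, fun i => (f i).2.1, fun i => (f i).2.2, ?_⟩
    intro i j hij v hv hv'
    simp only [Walk.support_nil, List.mem_singleton] at hv hv'
    exact hij (f.injective (Subtype.ext (hv.symm.trans hv')))
  obtain ⟨x₀, y₀, hxy₀⟩ := hE
  by_cases hk : ∀ S, Separates (G.deleteEdges {s(x₀, y₀)}) A B S → k ≤ S.ncard
  · refine (ih _ ?_ (G.deleteEdges {s(x₀, y₀)}) A B hk rfl).mono (deleteEdges_le _)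
    rw [← hn, edgeSet_deleteEdges]
    exact Set.ncard_sdiff_singleton_lt_of_mem hxy₀ (Set.toFinite _)
  push Not at hk
  obtain ⟨S, hS, hSk⟩ := hk
  have hnS : ¬ Separates G A B S := fun h' => (h S h').not_gt hSk
  obtain ⟨x, y, hxy, hS, a₀, ha₀, b₀, hb₀, hax, hyb⟩ : ∃ x y, G.Adj x y ∧
      Separates (G.deleteEdges {s(x, y)}) A B S ∧ ∃ a₀ ∈ A, ∃ b₀ ∈ B,
      JoinedWithin (G.deleteEdges {s(x, y)}) Sᶜ a₀ x ∧
      JoinedWithin (G.deleteEdges {s(x, y)}) Sᶜ y b₀ := by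
    unfold Separates at hnS
    push Not at hnS
    obtain ⟨a, ha, b, hb, hab⟩ := hnS
    rcases hab.deleteEdge_cases x₀ y₀ with h | ⟨h, h'⟩ | ⟨h, h'⟩
    · exact (hS a ha b hb h).elim
    · exact ⟨x₀, y₀, hxy₀, hS, a, ha, b, hb, h, h'⟩
    · rw [Sym2.eq_swap] at hS h h'
      exact ⟨y₀, x₀, hxy₀.symm, hS, a, ha, b, hb, h, h'⟩
  have hxS : x ∉ S := hax.right_mem
  have hyS : y ∉ S := hyb.left_mem
  have hlt : (G.deleteEdges {s(x, y)}).edgeSet.ncard < n := by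
    rw [← hn, edgeSet_deleteEdges]
    exact Set.ncard_sdiff_singleton_lt_of_mem hxy (Set.toFinite _)
  have hcard : ∀ z, (insert z S).ncard ≤ k := fun z => (Set.ncard_insert_le _ _).trans hSk
  have L₁ := ih _ hlt (G.deleteEdges {s(x, y)}) A (insert x S)
    (fun R hR => h R (hS.of_deleteEdge hb₀ hyb hR)) rfl
  have L₂ := ih _ hlt (G.deleteEdges {s(x, y)}) B (insert y S) (fun R hR => by
    have hyx : s(x, y) = s(y, x) := Sym2.eq_swap
    rw [hyx] at hS hax hR
    exact h R (hS.symm.of_deleteEdge ha₀ hax.symm hR).symm) rfl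
  obtain ⟨a₁, b₁, w₁, ha₁, hb₁, hd₁, hi₁, -, ht₁⟩ := L₁.exists_trimmed (hcard x)
  obtain ⟨a₂, b₂, w₂, ha₂, hb₂, hd₂, hi₂, hs₂, ht₂⟩ := L₂.exists_trimmed (hcard y)
  have hcompl : ∀ z, (insert z S)ᶜ ⊆ Sᶜ := fun z =>
    Set.compl_subset_compl.2 (Set.subset_insert _ _)
  have hmeet : ∀ i j v, v ∈ (w₁ i).support → v ∈ (w₂ j).support → v = b₁ i ∧ v = b₂ j := by
    intro i j v hv₁ hv₂
    have key : ∀ a ∈ A, ∀ b ∈ B, JoinedWithin (G.deleteEdges {s(x, y)}) Sᶜ a v →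
        JoinedWithin (G.deleteEdges {s(x, y)}) Sᶜ b v → False :=
      fun a ha b hb h₁ h₂ => hS a ha b hb (h₁.trans h₂.symm)
    rcases ht₁ i v hv₁ with h₁ | h₁ <;> rcases ht₂ j v hv₂ with h₂ | h₂
    · exact ⟨h₁, h₂⟩
    · exfalso
      have h₂ := h₂.mono le_rfl (hcompl y)
      have hvS := h₂.right_mem
      have hvx : v = x := (h₁ ▸ hb₁ i : v ∈ insert x S).resolve_right hvS
      exact key a₀ ha₀ _ (ha₂ j) (hvx ▸ hax) h₂
    · exfalso
      have h₁ := h₁.mono le_rfl (hcompl x)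
      have hvS := h₁.right_mem
      have hvy : v = y := (h₂ ▸ hb₂ j : v ∈ insert y S).resolve_right hvS
      exact key _ (ha₁ i) b₀ hb₀ h₁ (hvy ▸ hyb.symm)
    · exact (key _ (ha₁ i) _ (ha₂ j) (h₁.mono le_rfl (hcompl x)) (h₂.mono le_rfl (hcompl y))).elim
  have hσ : ∀ i, ∃ j, (b₁ i ∈ S ∧ b₂ j = b₁ i) ∨ (b₁ i = x ∧ b₂ j = y) := by
    intro i
    by_cases hi : b₁ i ∈ S
    · obtain ⟨j, hj⟩ := hs₂ _ (Set.mem_insert_of_mem y hi)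
      exact ⟨j, .inl ⟨hi, hj⟩⟩
    · obtain ⟨j, hj⟩ := hs₂ y (Set.mem_insert y S)
      exact ⟨j, .inr ⟨(hb₁ i).resolve_right hi, hj⟩⟩
  choose σ hσ using hσ
  have hσi : Function.Injective σ := by
    intro i j hij
    apply hi₁
    have hi := hσ i
    have hj := hσ j
    rw [hij] at hi
    grind
  have hle : G.deleteEdges {s(x, y)} ≤ G := deleteEdges_le _
  have hW : ∀ i, ∃ W : G.Walk (a₁ i) (a₂ (σ i)), ∀ v ∈ W.support,
      v ∈ (w₁ i).support ∨ v ∈ (w₂ (σ i)).support := by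
    intro i
    have hj : JoinedWithin G {v | v ∈ (w₁ i).support ∨ v ∈ (w₂ (σ i)).support}
        (a₁ i) (a₂ (σ i)) := by
      refine JoinedWithin.trans (v := b₁ i) ⟨(w₁ i).mapLe hle, by simp +contextual⟩ ?_
      refine JoinedWithin.trans (v := b₂ (σ i)) ?_
        (JoinedWithin.symm ⟨(w₂ (σ i)).mapLe hle, by simp +contextual⟩)
      have h₁ : b₁ i ∈ {v | v ∈ (w₁ i).support ∨ v ∈ (w₂ (σ i)).support} :=
        .inl (w₁ i).end_mem_support
      have h₂ : b₂ (σ i) ∈ {v | v ∈ (w₁ i).support ∨ v ∈ (w₂ (σ i)).support} :=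
        .inr (w₂ (σ i)).end_mem_support
      rcases hσ i with ⟨-, h⟩ | ⟨h, h'⟩
      · exact .of_eq h.symm h₁
      · refine .of_adj ?_ h₁ h₂
        rw [h, h']
        exact hxy
    exact hj
  choose W hW using hW
  refine ⟨a₁, fun i => a₂ (σ i), W, ha₁, fun i => ha₂ _, fun i j hij v hv hv' => ?_⟩
  have cross : ∀ i j, i ≠ j → v ∈ (w₁ i).support → v ∈ (w₂ (σ j)).support → False := by
    intro i j hij h₁ h₂
    obtain ⟨e₁, e₂⟩ := hmeet _ _ _ h₁ h₂
    refine hij (hi₁ ?_)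
    have hi := hσ i
    have hj := hσ j
    have hb := hb₁ i
    have hxy' := hxy.ne
    grind
  rcases hW i v hv with h₁ | h₁ <;> rcases hW j v hv' with h₂ | h₂
  · exact hd₁ i j hij v h₁ h₂
  · exact cross i j hij h₁ h₂
  · exact cross j i hij.symm h₂ h₁
  · exact hd₂ _ _ (fun e => hij (hσi e)) v h₁ h₂

end Menger

/-- An induced subgraph is connected iff its nonempty vertex set is joined within itself. -/
theorem induce_connected_iff_joinedWithin {α : Type*} {G : SimpleGraph α} {S : Set α} :
    (G.induce S).Connected ↔ S.Nonempty ∧ ∀ u ∈ S, ∀ v ∈ S, JoinedWithin G S u v := by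
  constructor
  · intro h
    refine ⟨Set.nonempty_coe_sort.1 h.nonempty, fun u hu v hv => ?_⟩
    obtain ⟨w⟩ := h.preconnected ⟨u, hu⟩ ⟨v, hv⟩
    have hw : ∀ x ∈ (w.map (Embedding.induce S).toHom).support, x ∈ S := by
      intro x hx
      rw [Walk.support_map, List.mem_map] at hx
      obtain ⟨y, -, rfl⟩ := hx
      exact y.2
    exact ⟨_, hw⟩
  · rintro ⟨⟨s, hs⟩, h⟩
    have : Nonempty S := ⟨⟨s, hs⟩⟩
    refine ⟨fun u v => ?_⟩
    obtain ⟨w, hw⟩ := h u u.2 v v.2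
    exact ⟨w.induce S hw⟩

theorem JoinedWithin.map {α β : Type*} {G : SimpleGraph α} {H : SimpleGraph β} {S : Set α}
    {T : Set β} {u v : α} (f : G →g H) (hf : ∀ x ∈ S, f x ∈ T) (h : JoinedWithin G S u v) :
    JoinedWithin H T (f u) (f v) := by
  obtain ⟨w, hw⟩ := h
  refine ⟨w.map f, fun x hx => ?_⟩
  rw [Walk.support_map, List.mem_map] at hx
  obtain ⟨y, hy, rfl⟩ := hx
  exact hf y (hw y hy)

section AddLeaf

variable {ι : Type*} {T : SimpleGraph ι} {t₀ : ι}

/-- The graph `T` together with a new vertex `none` adjacent to `t₀` only. -/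
def addLeaf (T : SimpleGraph ι) (t₀ : ι) : SimpleGraph (Option ι) where
  Adj
    | some a, some b => T.Adj a b
    | some a, none => a = t₀
    | none, some b => b = t₀
    | none, none => False
  symm := ⟨by rintro (_ | a) (_ | b) h <;> first | exact h | exact T.adj_symm h⟩
  loopless := ⟨by rintro (_ | a) h <;> [exact h; exact T.loopless.irrefl a h]⟩

/-- The inclusion of `T` into `addLeaf T t₀`. -/
def addLeafHom (T : SimpleGraph ι) (t₀ : ι) : T →g addLeaf T t₀ where
  toFun := some
  map_rel' h := h

theorem addLeaf_isTree (hT : T.IsTree) (t₀ : ι) : (addLeaf T t₀).IsTree := by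
  have hnone : (addLeaf T t₀).Adj none (some t₀) := rfl
  refine ⟨?_, ?_⟩
  · have h : ∀ x, (addLeaf T t₀).Reachable (some t₀) x := by
      rintro (_ | x)
      · exact hnone.symm.reachable
      · exact (hT.connected.preconnected t₀ x).map (addLeafHom T t₀)
    exact ⟨fun x y => (h x).symm.trans (h y)⟩
  · rw [isAcyclic_iff_forall_adj_isBridge]
    have hleaf : ∀ x, ¬ ((addLeaf T t₀).deleteEdges {s(none, some t₀)}).Reachable none (some x) := by
      rintro x ⟨w⟩
      cases w with
      | @cons _ c _ h p =>
        rw [deleteEdges_adj] at h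
        obtain ⟨h₁, h₂⟩ := h
        cases c with
        | none => exact h₁
        | some c =>
          have hc : c = t₀ := h₁
          exact h₂ (by simp [hc])
    rintro (_ | a) (_ | b) hab
    · exact hab.elim
    · obtain rfl : b = t₀ := hab
      rw [isBridge_iff]
      exact hleaf b
    · obtain rfl : a = t₀ := hab
      rw [Sym2.eq_swap, isBridge_iff]
      exact hleaf a
    · have hT' : T.Adj a b := hab
      have hb := isAcyclic_iff_forall_adj_isBridge.1 hT.isAcyclic hT'
      rw [isBridge_iff] at hb ⊢
      rintro ⟨w⟩
      apply hb
      have key : ∀ {x y : Option ι} (_ : ((addLeaf T t₀).deleteEdges {s(some a, some b)}).Walk x y),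
          (T.deleteEdges {s(a, b)}).Reachable (x.getD t₀) (y.getD t₀) := by
        intro x y w
        induction w with
        | nil => exact .refl _
        | @cons x y z h p ih =>
          refine .trans ?_ ih
          rw [deleteEdges_adj] at h
          obtain ⟨h₁, h₂⟩ := h
          cases x with
          | none =>
            cases y with
            | none => exact h₁.elim
            | some y =>
              have hy : y = t₀ := h₁
              rw [hy]
              exact .refl _
          | some x =>
            cases y with
            | none =>
              have hx : x = t₀ := h₁
              rw [hx]
              exact .refl _
            | some y =>
              refine Adj.reachable ?_
              rw [deleteEdges_adj]
              exact ⟨h₁, fun h => h₂ (by simpa using h)⟩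
      exact key w

end AddLeaf

section PartialDecomp

variable {α : Type*}

/-- The vertex set of the component of `c` in `G - U`. -/
def compAvoiding (G : SimpleGraph α) (U : Set α) (c : α) : Set α :=
  {v | JoinedWithin G Uᶜ c v}

/-- The vertices of `U` with a neighbour in the component of `c` in `G - U`. -/
def attachments (G : SimpleGraph α) (U : Set α) (c : α) : Set α :=
  {u | u ∈ U ∧ ∃ v ∈ compAvoiding G U c, G.Adj v u}

variable {G : SimpleGraph α} {U D : Set α} {c d u v : α} {n : ℕ}

theorem mem_compAvoiding_self (hc : c ∉ U) : c ∈ compAvoiding G U c := JoinedWithin.refl hc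

theorem notMem_of_mem_compAvoiding (h : v ∈ compAvoiding G U c) : v ∉ U :=
  JoinedWithin.right_mem h

theorem mem_compAvoiding_of_adj (hu : u ∈ compAvoiding G U c) (h : G.Adj u v) (hv : v ∉ U) :
    v ∈ compAvoiding G U c :=
  JoinedWithin.trans hu (.of_adj h (notMem_of_mem_compAvoiding hu) hv)

theorem mem_attachments_of_adj (hu : u ∈ compAvoiding G U c) (h : G.Adj u v)
    (hv : v ∉ compAvoiding G U c) : v ∈ attachments G U c :=
  ⟨by_contra fun hvU => hv (mem_compAvoiding_of_adj hu h hvU), u, hu, h⟩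

theorem joinedWithin_compAvoiding (hu : u ∈ compAvoiding G U c) (hv : v ∈ compAvoiding G U c) :
    JoinedWithin G (compAvoiding G U c) u v := by
  suffices h : ∀ x ∈ compAvoiding G U c, JoinedWithin G (compAvoiding G U c) c x from
    (h u hu).symm.trans (h v hv)
  rintro x ⟨w, hw⟩
  exact ⟨w, fun z hz => JoinedWithin.of_mem_support w hw hz⟩

theorem compAvoiding_eq_of_mem (h : d ∈ compAvoiding G U c) :
    compAvoiding G U d = compAvoiding G U c :=
  Set.ext fun _ => ⟨fun h' => JoinedWithin.trans h h',
    fun h' => JoinedWithin.trans (JoinedWithin.symm h) h'⟩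

theorem attachments_eq_of_mem (h : d ∈ compAvoiding G U c) :
    attachments G U d = attachments G U c := by
  unfold attachments
  rw [compAvoiding_eq_of_mem h]

theorem compAvoiding_union_subset : compAvoiding G (U ∪ D) c ⊆ compAvoiding G U c :=
  fun _ h => JoinedWithin.mono h le_rfl (Set.compl_subset_compl.2 Set.subset_union_left)

theorem attachments_union_subset (hd : d ∈ compAvoiding G U c) :
    attachments G (U ∪ D) d ⊆ attachments G U c ∪ D := by
  rintro u ⟨hu, v, hv, hvu⟩
  rcases hu with hu | hu
  · refine .inl ⟨hu, v, ?_, hvu⟩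
    rw [← compAvoiding_eq_of_mem hd]
    exact compAvoiding_union_subset hv
  · exact .inr hu

/-- A component of `G - U` disjoint from `D` is still a component of `G - (U ∪ D)`. -/
theorem compAvoiding_union_eq (hD : Disjoint (compAvoiding G U d) D) :
    compAvoiding G (U ∪ D) d = compAvoiding G U d := by
  refine compAvoiding_union_subset.antisymm ?_
  rintro v ⟨w, hw⟩
  refine ⟨w, fun z hz hzUD => ?_⟩
  rcases hzUD with h | h
  · exact hw z hz h
  · exact Set.disjoint_left.1 hD (JoinedWithin.of_mem_support w hw hz) h

theorem attachments_union_eq (hD : Disjoint (compAvoiding G U d) D) (hd : D ∩ U = ∅) :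
    attachments G (U ∪ D) d = attachments G U d := by
  unfold attachments
  rw [compAvoiding_union_eq hD]
  ext u
  constructor
  · rintro ⟨hu | hu, v, hv, hvu⟩
    · exact ⟨hu, v, hv, hvu⟩
    · exact (Set.disjoint_left.1 hD (mem_compAvoiding_of_adj hv hvu
        fun h => (hd ▸ ⟨hu, h⟩ : u ∈ (∅ : Set α))) hu).elim
  · rintro ⟨hu, v, hv, hvu⟩
    exact ⟨.inl hu, v, hv, hvu⟩

/-- `G[U]` has a tree decomposition into bags of at most `n` vertices such that the attachments
of every component of `G - U` lie in a common bag. -/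
def PartialDecomp (G : SimpleGraph α) (n : ℕ) (U : Set α) : Prop :=
  ∃ (ι : Type) (T : SimpleGraph ι) (X : ι → Set α), T.IsTree ∧ (∀ t, X t ⊆ U) ∧
    (∀ u ∈ U, ∀ v ∈ U, G.Adj u v → ∃ t, u ∈ X t ∧ v ∈ X t) ∧
    (∀ v ∈ U, (T.induce {t | v ∈ X t}).Connected) ∧
    (∀ t, (X t).ncard ≤ n) ∧ ∀ c ∉ U, ∃ t, attachments G U c ⊆ X t

theorem PartialDecomp.empty (G : SimpleGraph α) (n : ℕ) : PartialDecomp G n ∅ :=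
  ⟨Unit, ⊥, fun _ => ∅, .of_subsingleton, by simp, by simp, by simp, by simp,
    fun c _ => ⟨(), fun _ h => h.1⟩⟩

theorem PartialDecomp.extend (h : PartialDecomp G n U) (hc : c ∉ U)
    (hD : D ⊆ compAvoiding G U c) (hcard : (attachments G U c ∪ D).ncard ≤ n) :
    PartialDecomp G n (U ∪ D) := by
  obtain ⟨ι, T, X, hT, hXU, hadj, hconn, hXn, hatt⟩ := h
  obtain ⟨t₀, ht₀⟩ := hatt c hc
  have hDU : ∀ d ∈ D, d ∉ U := fun d hd => notMem_of_mem_compAvoiding (hD hd)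
  have hattU : attachments G U c ⊆ U := fun _ h => h.1
  refine ⟨Option ι, addLeaf T t₀, fun t => t.elim (attachments G U c ∪ D) X,
    addLeaf_isTree hT t₀, ?_, ?_, ?_, ?_, ?_⟩
  · rintro (_ | t)
    · exact Set.union_subset_union_left _ hattU
    · exact (hXU t).trans Set.subset_union_left
  · have key : ∀ u ∈ D, ∀ v ∈ U ∪ D, G.Adj u v → v ∈ attachments G U c ∪ D := by
      rintro u hu v (hv | hv) huv
      · exact .inl ⟨hv, u, hD hu, huv⟩
      · exact .inr hv
    intro u hu v hv huv
    by_cases huD : u ∈ D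
    · exact ⟨none, .inr huD, key u huD v hv huv⟩
    by_cases hvD : v ∈ D
    · exact ⟨none, key v hvD u hu huv.symm, .inr hvD⟩
    obtain ⟨t, ht⟩ := hadj u (hu.resolve_right huD) v (hv.resolve_right hvD) huv
    exact ⟨some t, ht⟩
  · intro v hv
    rw [induce_connected_iff_joinedWithin]
    by_cases hvD : v ∈ D
    · have hmem : ∀ t : Option ι, v ∈ t.elim (attachments G U c ∪ D) X → t = none := by
        rintro (_ | t) ht
        · rfl
        · exact (hDU v hvD (hXU t ht)).elim
      refine ⟨⟨none, .inr hvD⟩, fun s hs t ht => ?_⟩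
      exact .of_eq ((hmem s hs).trans (hmem t ht).symm) hs
    · have hvU := hv.resolve_right hvD
      obtain ⟨⟨s, hs⟩, hj⟩ := induce_connected_iff_joinedWithin.1 (hconn v hvU)
      have hj' : ∀ t t', v ∈ X t → v ∈ X t' → JoinedWithin (addLeaf T t₀)
          {t | v ∈ t.elim (attachments G U c ∪ D) X} (some t) (some t') := fun t t' ht ht' =>
        (hj t ht t' ht').map (addLeafHom T t₀) fun x hx => hx
      have hn : v ∈ attachments G U c ∪ D → JoinedWithin (addLeaf T t₀)
          {t | v ∈ t.elim (attachments G U c ∪ D) X} none (some t₀) := fun hv' =>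
        .of_adj rfl hv' (ht₀ (hv'.resolve_right hvD))
      refine ⟨⟨some s, hs⟩, ?_⟩
      rintro (_ | t) ht (_ | t') ht'
      · exact .refl ht
      · exact (hn ht).trans (hj' _ _ (ht₀ (ht.resolve_right hvD)) ht')
      · exact ((hn ht').trans (hj' _ _ (ht₀ (ht'.resolve_right hvD)) ht)).symm
      · exact hj' _ _ ht ht'
  · rintro (_ | t)
    · exact hcard
    · exact hXn t
  · intro d hd
    have hdU : d ∉ U := fun h => hd (.inl h)
    by_cases hdc : d ∈ compAvoiding G U c
    · exact ⟨none, attachments_union_subset hdc⟩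
    · obtain ⟨t, ht⟩ := hatt d hdU
      refine ⟨some t, ?_⟩
      rw [attachments_union_eq]
      · exact ht
      · rw [Set.disjoint_left]
        intro x hx hxD
        refine hdc ?_
        rw [← compAvoiding_eq_of_mem (hD hxD), compAvoiding_eq_of_mem hx]
        exact mem_compAvoiding_self hdU
      · ext x
        simpa using hDU x

theorem PartialDecomp.treewidth_le (h : PartialDecomp G (n + 1) Set.univ) : treewidth G ≤ n := by
  obtain ⟨ι, T, X, hT, -, hadj, hconn, hXn, -⟩ := h
  refine Nat.sInf_le ⟨ι, T, X, hT, ⟨fun v => ?_, fun u v => hadj u trivial v trivial,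
    fun v => hconn v trivial⟩, hXn⟩
  obtain ⟨t⟩ := (hconn v trivial).nonempty
  exact ⟨t, t.2⟩

end PartialDecomp

namespace JoinedWithin

variable {α : Type*} {G H : SimpleGraph α} {S : Set α} {u v : α}

theorem exists_exit (h : JoinedWithin G S u v) {P : Set α} (hu : u ∈ P) (hv : v ∉ P) :
    ∃ a ∈ P, ∃ b ∉ P, b ∈ S ∧ G.Adj a b ∧ JoinedWithin G (S ∩ P) u a := by
  obtain ⟨w, hw⟩ := h
  induction w with
  | nil => exact (hv hu).elim
  | @cons a c b hac p ih =>
    have ha : a ∈ S := hw _ (by simp)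
    have hc : c ∈ S := hw _ (by simp)
    by_cases hcP : c ∈ P
    · obtain ⟨x, hx, y, hy, hyS, hxy, hj⟩ := ih hcP hv fun z hz => hw z (by simp [hz])
      exact ⟨x, hx, y, hy, hyS, hxy, (of_adj (S := S ∩ P) hac ⟨ha, hu⟩ ⟨hc, hcP⟩).trans hj⟩
    · exact ⟨a, hu, c, hcP, hc, hac, refl ⟨ha, hu⟩⟩

theorem mono_of_adj (h : JoinedWithin G S u v)
    (hadj : ∀ a ∈ S, ∀ b ∈ S, G.Adj a b → H.Adj a b) : JoinedWithin H S u v := by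
  obtain ⟨w, hw⟩ := h
  induction w with
  | nil => exact refl (hw _ (by simp))
  | @cons a c b hac p ih =>
    have ha : a ∈ S := hw _ (by simp)
    have hc : c ∈ S := hw _ (by simp)
    exact (of_adj (hadj a ha c hc hac) ha hc).trans (ih fun z hz => hw z (by simp [hz]))

end JoinedWithin

section PathDegree

variable {α : Type*} {G : SimpleGraph α} {u v x : α}

/-- A walk through `A` contains a path from `A` to its end with no later vertex in `A`. -/
theorem exists_isPath_from_last {A : Set α} (w : G.Walk u v) (h : ∃ x ∈ w.support, x ∈ A) :
    ∃ a ∈ A, ∃ p : G.Walk a v, p.IsPath ∧ (∀ x ∈ p.support, x ∈ w.support) ∧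
      ∀ x ∈ p.support, x ∈ A → x = a := by
  classical
  suffices h' : ∃ a ∈ A, ∃ p : G.Walk a v, (∀ x ∈ p.support, x ∈ w.support) ∧
      ∀ x ∈ p.support, x ∈ A → x = a by
    obtain ⟨a, ha, p, hp, hpA⟩ := h'
    exact ⟨a, ha, p.bypass, p.bypass_isPath,
      fun x hx => hp x (p.support_bypass_subset_support hx),
      fun x hx => hpA x (p.support_bypass_subset_support hx)⟩
  induction w with
  | nil =>
    obtain ⟨x, hx, hxA⟩ := h
    obtain rfl : x = _ := by simpa using hx
    exact ⟨x, hxA, .nil, by simp, by simp⟩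
  | @cons a c b hac p ih =>
    by_cases hp : ∃ x ∈ p.support, x ∈ A
    · obtain ⟨a', ha', p', h₁, h₂⟩ := ih hp
      exact ⟨a', ha', p', fun x hx => by simp [h₁ x hx], h₂⟩
    · push Not at hp
      have ha : a ∈ A := by
        obtain ⟨x, hx, hxA⟩ := h
        rw [Walk.support_cons, List.mem_cons] at hx
        rcases hx with rfl | hx
        · exact hxA
        · exact (hp x hx hxA).elim
      refine ⟨a, ha, .cons hac p, fun x hx => hx, fun x hx hxA => ?_⟩
      rw [Walk.support_cons, List.mem_cons] at hx
      exact hx.resolve_right fun hx => hp x hx hxA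

theorem SimpleGraph.Walk.IsPath.ncard_neighborSet_start_le {p : G.Walk u v} (hp : p.IsPath) :
    (p.toSubgraph.neighborSet u).ncard ≤ 1 := by
  by_cases hn : p.Nil
  · have : p.toSubgraph.neighborSet u = ∅ := by
      ext y
      rw [Subgraph.mem_neighborSet, Walk.adj_toSubgraph_iff_mem_edges]
      cases hn
      simp
    simp [this]
  · rw [hp.neighborSet_toSubgraph_startpoint hn]
    simp

theorem SimpleGraph.Walk.IsPath.ncard_neighborSet_end_le {p : G.Walk u v} (hp : p.IsPath) :
    (p.toSubgraph.neighborSet v).ncard ≤ 1 := by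
  simpa using hp.reverse.ncard_neighborSet_start_le

theorem SimpleGraph.Walk.IsPath.ncard_neighborSet_le {p : G.Walk u v} (hp : p.IsPath) (x : α) :
    (p.toSubgraph.neighborSet x).ncard ≤ 2 := by
  by_cases hx : x ∈ p.support
  · obtain ⟨i, rfl, hi⟩ := Walk.mem_support_iff_exists_getVert.1 hx
    rcases Nat.eq_zero_or_pos i with rfl | hi0
    · rw [Walk.getVert_zero]
      exact hp.ncard_neighborSet_start_le.trans one_le_two
    · rcases hi.lt_or_eq with hi | rfl
      · exact (hp.ncard_neighborSet_toSubgraph_internal_eq_two hi0.ne' hi).le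
      · rw [Walk.getVert_length]
        exact hp.ncard_neighborSet_end_le.trans one_le_two
  · have : p.toSubgraph.neighborSet x = ∅ := by
      ext y
      simp only [Subgraph.mem_neighborSet, Set.mem_empty_iff_false, iff_false]
      intro h
      exact hx (p.mem_verts_toSubgraph.1 h.fst_mem)
    simp [this]

end PathDegree

/-- A connected graph of maximum degree at most `3` avoiding the component `C` of `G - U` with
attachment set `X`, containing `X`, where vertices of `X` have degree at most `2` and some vertex
of `X` has degree at most `1`. -/
structure IsPremesh {α : Type*} (G : SimpleGraph α) (h : ℕ) (C X : Set α) (H : SimpleGraph α)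
    (W : Set α) : Prop where
  le : H ≤ G
  mem_of_adj : ∀ u v, H.Adj u v → u ∈ W
  notMem : ∀ v ∈ W, v ∉ C
  subset : X ⊆ W
  reachable : ∀ u ∈ W, ∀ v ∈ W, H.Reachable u v
  degree_le : ∀ v, (H.neighborSet v).ncard ≤ 3
  degree_le_of_mem : ∀ v ∈ X, (H.neighborSet v).ncard ≤ 2
  exists_leaf : X.Nonempty → ∃ v ∈ X, (H.neighborSet v).ncard ≤ 1
  card_le : X.ncard ≤ h

/-- The graph on `C ∪ R` whose edges are the edges of `G` there with at least one end in `C`. -/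
def outerGraph {α : Type*} (G : SimpleGraph α) (C R : Set α) : SimpleGraph α where
  Adj a b := G.Adj a b ∧ (a ∈ C ∨ b ∈ C) ∧ a ∈ C ∪ R ∧ b ∈ C ∪ R
  symm := ⟨fun _ _ h => ⟨h.1.symm, h.2.1.symm, h.2.2.2, h.2.2.1⟩⟩
  loopless := ⟨fun _ h => h.1.ne rfl⟩

theorem outerGraph_le {α : Type*} (G : SimpleGraph α) (C R : Set α) : outerGraph G C R ≤ G :=
  fun _ _ h => h.1

theorem outerGraph_mem_of_mem_support {α : Type*} {G : SimpleGraph α} {C R : Set α} {u v x : α}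
    (w : (outerGraph G C R).Walk u v) (hu : u ∈ C ∪ R) (hx : x ∈ w.support) : x ∈ C ∪ R := by
  induction w with
  | nil =>
    obtain rfl : x = _ := by simpa using hx
    exact hu
  | cons h p ih =>
    rw [Walk.support_cons, List.mem_cons] at hx
    rcases hx with rfl | hx
    · exact hu
    · exact ih h.2.2.2 hx

section Premesh

variable {α : Type*} {G H : SimpleGraph α} {U W D : Set α} {c c' : α} {h k : ℕ}

/-- If `D` meets a component of `G - U` then every smaller component of `G - (U ∪ D)` inside it
attaches to `D`. -/
theorem exists_mem_attachments {d : α} (hc' : c' ∈ compAvoiding G U c) (hcD : c' ∉ D)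
    (hd : d ∈ D) (hdC : d ∈ compAvoiding G U c) : ∃ x ∈ D, x ∈ attachments G (U ∪ D) c' := by
  have hcU : c' ∉ U ∪ D := fun h => h.elim (notMem_of_mem_compAvoiding hc') hcD
  obtain ⟨a, ha, b, hb, hbC, hab, -⟩ := (joinedWithin_compAvoiding hc' hdC).exists_exit
    (P := compAvoiding G (U ∪ D) c') (mem_compAvoiding_self hcU)
    (fun h => notMem_of_mem_compAvoiding h (.inr hd))
  have hb' := mem_attachments_of_adj ha hab hb
  exact ⟨b, hb'.1.resolve_left (notMem_of_mem_compAvoiding hbC), hb'⟩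

theorem IsPremesh.extend_leaf [Finite α]
    (hM : IsPremesh G h (compAvoiding G U c) (attachments G U c) H W)
    (hlt : (attachments G U c).ncard < h) {x v : α} (hx : x ∈ attachments G U c)
    (hdeg : (H.neighborSet x).ncard ≤ 1) (hv : v ∈ compAvoiding G U c) (hvx : G.Adj v x)
    (hc' : c' ∈ compAvoiding G U c) (hne : c' ≠ v) :
    ∃ H' W', IsPremesh G h (compAvoiding G (U ∪ {v}) c') (attachments G (U ∪ {v}) c') H' W' := by
  have hxW := hM.subset hx
  have hvW : v ∉ W := fun h => hM.notMem v h hv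
  have hXsub : attachments G (U ∪ {v}) c' ⊆ insert v (attachments G U c) := by
    rw [← Set.union_singleton, ← attachments_eq_of_mem hc']
    exact attachments_union_subset (mem_compAvoiding_self (notMem_of_mem_compAvoiding hc'))
  have hCsub : compAvoiding G (U ∪ {v}) c' ⊆ compAvoiding G U c := by
    rw [← compAvoiding_eq_of_mem hc']
    exact compAvoiding_union_subset
  have hadj : ∀ a b, (H ⊔ edge x v).Adj a b ↔ H.Adj a b ∨ (a = x ∧ b = v) ∨ (a = v ∧ b = x) := by
    intro a b
    rw [sup_adj, edge_adj]
    have := hvx.ne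
    constructor
    · rintro (h | ⟨⟨rfl, rfl⟩ | ⟨rfl, rfl⟩, -⟩) <;> simp_all
    · rintro (h | ⟨rfl, rfl⟩ | ⟨rfl, rfl⟩) <;> simp_all [this.symm]
  have hHv : ∀ b, ¬ H.Adj v b := fun b h => hvW (hM.mem_of_adj _ _ h)
  have hnv : ((H ⊔ edge x v).neighborSet v).ncard ≤ 1 := by
    refine (Set.ncard_le_ncard (t := {x}) ?_).trans (by simp)
    intro b hb
    rcases (hadj v b).1 hb with h | ⟨h, -⟩ | ⟨-, h⟩
    · exact (hHv b h).elim
    · exact (hvx.ne h).elim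
    · exact h
  have hnx : ((H ⊔ edge x v).neighborSet x).ncard ≤ 2 := by
    refine (Set.ncard_le_ncard (t := insert v (H.neighborSet x)) ?_).trans
      ((Set.ncard_insert_le _ _).trans (by lia))
    intro b hb
    rcases (hadj x b).1 hb with h | ⟨-, h⟩ | ⟨h, -⟩
    · exact .inr h
    · exact .inl h
    · exact (hvx.ne h.symm).elim
  have hn : ∀ y, y ≠ x → y ≠ v → (H ⊔ edge x v).neighborSet y = H.neighborSet y := by
    intro y hyx hyv
    ext b
    rw [mem_neighborSet, mem_neighborSet, hadj]
    simp [hyx, hyv]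
  refine ⟨H ⊔ edge x v, insert v W, ?_, ?_, ?_, ?_, ?_, ?_, ?_, ?_, ?_⟩
  · intro a b hab
    rcases (hadj a b).1 hab with h | ⟨rfl, rfl⟩ | ⟨rfl, rfl⟩
    · exact hM.le h
    · exact hvx.symm
    · exact hvx
  · intro a b hab
    rcases (hadj a b).1 hab with h | ⟨rfl, rfl⟩ | ⟨rfl, rfl⟩
    · exact .inr (hM.mem_of_adj _ _ h)
    · exact .inr hxW
    · exact .inl rfl
  · rintro a (rfl | ha) haC
    · exact notMem_of_mem_compAvoiding haC (.inr rfl)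
    · exact hM.notMem a ha (hCsub haC)
  · exact hXsub.trans (Set.insert_subset_insert hM.subset)
  · have hr : ∀ u ∈ insert v W, (H ⊔ edge x v).Reachable x u := by
      rintro u (rfl | hu)
      · exact Adj.reachable ((hadj _ _).2 (.inr (.inl ⟨rfl, rfl⟩)))
      · exact (hM.reachable x hxW u hu).mono le_sup_left
    exact fun u hu u' hu' => (hr u hu).symm.trans (hr u' hu')
  · intro y
    by_cases hyx : y = x
    · subst hyx; lia
    by_cases hyv : y = v
    · subst hyv; lia
    rw [hn y hyx hyv]
    exact hM.degree_le y
  · intro y hy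
    by_cases hyx : y = x
    · subst hyx; lia
    by_cases hyv : y = v
    · subst hyv; lia
    rw [hn y hyx hyv]
    exact hM.degree_le_of_mem y ((hXsub hy).resolve_left hyv)
  · intro _
    obtain ⟨d, rfl, hd⟩ := exists_mem_attachments (D := {v}) hc' hne rfl hv
    exact ⟨d, hd, hnv⟩
  · exact (Set.ncard_le_ncard hXsub).trans ((Set.ncard_insert_le _ _).trans hlt)

theorem isPremesh_of_attachments_eq_empty [Finite α] (hX : attachments G U c = ∅) (hh : 0 < h)
    (hc' : c' ∈ compAvoiding G U c) (hne : c' ≠ c) (hc : c ∉ U) :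
    IsPremesh G h (compAvoiding G (U ∪ {c}) c') (attachments G (U ∪ {c}) c') ⊥ {c} := by
  have hXsub : attachments G (U ∪ {c}) c' ⊆ {c} := by
    have := attachments_union_subset (D := {c}) (G := G)
      (mem_compAvoiding_self (G := G) (notMem_of_mem_compAvoiding hc'))
    rwa [attachments_eq_of_mem hc', hX, Set.empty_union] at this
  refine ⟨bot_le, by simp, ?_, hXsub, ?_, by simp, by simp,
    fun ⟨v, hv⟩ => ⟨v, hv, by simp⟩, ?_⟩
  · rintro _ rfl hC
    exact notMem_of_mem_compAvoiding hC (.inr rfl)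
  · rintro u rfl v rfl
    exact .refl _
  · refine (Set.ncard_le_ncard hXsub).trans ?_
    rwa [Set.ncard_singleton]

end Premesh

section Premesh

variable {α : Type*} {G H : SimpleGraph α} {U W D : Set α} {c c' : α} {h k : ℕ}

theorem IsPremesh.extend_paths [Finite α] {ι : Type*}
    (hM : IsPremesh G h (compAvoiding G U c) (attachments G U c) H W)
    (hc' : c' ∈ compAvoiding G U c) (hcD : c' ∉ D) (hDC : D ⊆ compAvoiding G U c)
    (hD : D.Nonempty) {a b : ι → α} (p : ∀ i, G.Walk (a i) (b i)) (hp : ∀ i, (p i).IsPath)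
    (ha : ∀ i, a i ∈ attachments G U c) (ha' : ∀ i, a i ∉ attachments G (U ∪ D) c')
    (hbD : ∀ d ∈ D, ∃ i, b i = d)
    (hdisj : ∀ i j v, v ∈ (p i).support → v ∈ (p j).support → i = j)
    (hpC : ∀ i, ∀ v ∈ (p i).support, v = a i ∨ v ∈ compAvoiding G U c)
    (hpC' : ∀ i, ∀ v ∈ (p i).support, v ∉ compAvoiding G (U ∪ D) c')
    (hcard : (attachments G (U ∪ D) c').ncard ≤ h) :
    ∃ H' W', IsPremesh G h (compAvoiding G (U ∪ D) c') (attachments G (U ∪ D) c') H' W' := by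
  have hCsub : compAvoiding G (U ∪ D) c' ⊆ compAvoiding G U c := by
    rw [← compAvoiding_eq_of_mem hc']
    exact compAvoiding_union_subset
  have hXsub : attachments G (U ∪ D) c' ⊆ attachments G U c ∪ D := by
    rw [← attachments_eq_of_mem hc']
    exact attachments_union_subset (mem_compAvoiding_self (notMem_of_mem_compAvoiding hc'))
  have hCW : ∀ v ∈ compAvoiding G U c, ∀ y, ¬ H.Adj v y :=
    fun v hv y hvy => hM.notMem v (hM.mem_of_adj _ _ hvy) hv
  let H' : SimpleGraph α :=
    { Adj := fun x y => H.Adj x y ∨ ∃ i, (p i).toSubgraph.Adj x y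
      symm := ⟨fun x y hxy => hxy.imp (fun h => h.symm) fun ⟨i, hi⟩ => ⟨i, hi.symm⟩⟩
      loopless := ⟨fun x hx => hx.elim (fun h => h.ne rfl) fun ⟨i, hi⟩ => hi.ne rfl⟩ }
  have hHH' : H ≤ H' := fun _ _ h => .inl h
  have hsupp : ∀ i x y, (p i).toSubgraph.Adj x y → x ∈ (p i).support :=
    fun i x y hxy => (p i).mem_verts_toSubgraph.1 hxy.fst_mem
  have hnbr : ∀ i, ∀ v ∈ (p i).support,
      H'.neighborSet v = H.neighborSet v ∪ (p i).toSubgraph.neighborSet v := by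
    intro i v hv
    ext y
    constructor
    · rintro (h | ⟨j, hj⟩)
      · exact .inl h
      · obtain rfl := hdisj i j v hv (hsupp j v y hj)
        exact .inr hj
    · rintro (h | h)
      · exact .inl h
      · exact .inr ⟨i, h⟩
  have hnbrC : ∀ i, ∀ v ∈ (p i).support, v ∈ compAvoiding G U c →
      H'.neighborSet v = (p i).toSubgraph.neighborSet v := by
    intro i v hv hvC
    rw [hnbr i v hv]
    have : H.neighborSet v = ∅ := by
      ext y
      simpa using hCW v hvC y
    rw [this, Set.empty_union]
  have hnbr' : ∀ v, (∀ i, v ∉ (p i).support) → H'.neighborSet v = H.neighborSet v := by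
    intro v hv
    ext y
    exact ⟨fun h => h.resolve_right fun ⟨i, hi⟩ => hv i (hsupp i v y hi), .inl⟩
  have hnbrD : ∀ d ∈ D, (H'.neighborSet d).ncard ≤ 1 := by
    intro d hd
    obtain ⟨i, rfl⟩ := hbD d hd
    rw [hnbrC i _ (p i).end_mem_support (hDC hd)]
    exact (hp i).ncard_neighborSet_end_le
  have hXC : ∀ v ∈ attachments G U c, v ∉ compAvoiding G U c :=
    fun v hv hvC => notMem_of_mem_compAvoiding hvC hv.1
  refine ⟨H', W ∪ {v | ∃ i, v ∈ (p i).support}, ?_, ?_, ?_, ?_, ?_, ?_, ?_, ?_, hcard⟩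
  · rintro x y (hxy | ⟨i, hi⟩)
    · exact hM.le hxy
    · exact hi.adj_sub
  · rintro x y (hxy | ⟨i, hi⟩)
    · exact .inl (hM.mem_of_adj _ _ hxy)
    · exact .inr ⟨i, hsupp i x y hi⟩
  · rintro v (hv | ⟨i, hv⟩) hvC
    · exact hM.notMem v hv (hCsub hvC)
    · exact hpC' i v hv hvC
  · intro v hv
    rcases hXsub hv with h | h
    · exact .inl (hM.subset h)
    · obtain ⟨i, rfl⟩ := hbD v h
      exact .inr ⟨i, (p i).end_mem_support⟩
  · obtain ⟨d, hd⟩ := hD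
    obtain ⟨i₀, -⟩ := hbD d hd
    have hr : ∀ u ∈ W ∪ {v | ∃ i, v ∈ (p i).support}, H'.Reachable (a i₀) u := by
      rintro u (hu | ⟨i, hu⟩)
      · exact (hM.reachable _ (hM.subset (ha i₀)) u hu).mono hHH'
      · refine ((hM.reachable _ (hM.subset (ha i₀)) _ (hM.subset (ha i))).mono hHH').trans ?_
        have hle : (p i).toSubgraph.spanningCoe ≤ H' := fun x y hxy => .inr ⟨i, hxy⟩
        refine Reachable.mono hle ?_
        have hconn := (p i).toSubgraph_connected.coe.preconnected
          ⟨a i, (p i).start_mem_verts_toSubgraph⟩ ⟨u, (p i).mem_verts_toSubgraph.2 hu⟩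
        exact hconn.map (p i).toSubgraph.coeEmbeddingSpanningCoe.toHom
    exact fun u hu v hv => (hr u hu).symm.trans (hr v hv)
  · intro v
    by_cases hv : ∃ i, v ∈ (p i).support
    · obtain ⟨i, hi⟩ := hv
      rcases hpC i v hi with rfl | hvC
      · rw [hnbr i _ hi]
        refine (Set.ncard_union_le _ _).trans ?_
        have h₁ := hM.degree_le_of_mem _ (ha i)
        have h₂ := (hp i).ncard_neighborSet_start_le
        lia
      · rw [hnbrC i v hi hvC]
        exact ((hp i).ncard_neighborSet_le v).trans (by lia)
    · push Not at hv
      rw [hnbr' v hv]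
      exact hM.degree_le v
  · intro v hv
    rcases hXsub hv with h | h
    · have hv' : ∀ i, v ∉ (p i).support := by
        intro i hi
        rcases hpC i v hi with rfl | hvC
        · exact ha' i hv
        · exact hXC v h hvC
      rw [hnbr' v hv']
      exact hM.degree_le_of_mem v h
    · exact (hnbrD v h).trans one_le_two
  · intro _
    obtain ⟨d, hd⟩ := hD
    obtain ⟨x, hxD, hx⟩ := exists_mem_attachments hc' hcD hd (hDC hd)
    exact ⟨x, hx, hnbrD x hxD⟩

theorem IsPremesh.extend_side [Finite α]
    (hM : IsPremesh G h (compAvoiding G U c) (attachments G U c) H W) {R Y Z S : Set α}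
    (hZ : Z ⊆ attachments G U c) (hR : R ⊆ Y ∪ Z)
    (hS : Separates (outerGraph G (compAvoiding G U c) R) Z Y S)
    (hL : Linked (outerGraph G (compAvoiding G U c) R) Z S S.ncard) (hSZ : S.ncard < Z.ncard)
    (hD : (S ∩ compAvoiding G U c).Nonempty)
    (hc' : c' ∈ compAvoiding G U c) (hcS : c' ∉ S)
    (hatt : ∀ z ∈ Z, z ∈ attachments G (U ∪ (S ∩ compAvoiding G U c)) c' → z ∈ S) :
    ∃ H' W', IsPremesh G h (compAvoiding G (U ∪ (S ∩ compAvoiding G U c)) c')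
      (attachments G (U ∪ (S ∩ compAvoiding G U c)) c') H' W' := by
  set C := compAvoiding G U c with hC
  set K := outerGraph G C R with hK
  have hXC : ∀ v ∈ attachments G U c, v ∉ C :=
    fun v hv hvC => notMem_of_mem_compAvoiding hvC hv.1
  have hCsub : compAvoiding G (U ∪ (S ∩ C)) c' ⊆ C := by
    rw [hC, ← compAvoiding_eq_of_mem hc']
    exact compAvoiding_union_subset
  have hXsub : attachments G (U ∪ (S ∩ C)) c' ⊆ attachments G U c ∪ (S ∩ C) := by
    rw [← attachments_eq_of_mem hc']
    exact attachments_union_subset (mem_compAvoiding_self (notMem_of_mem_compAvoiding hc'))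
  have hCS : ∀ v ∈ compAvoiding G (U ∪ (S ∩ C)) c', v ∉ S := fun v hv hvS =>
    notMem_of_mem_compAvoiding hv (.inr ⟨hvS, hCsub hv⟩)
  -- walks from `Z` avoiding `S` do not enter the new component
  have havoid : ∀ z ∈ Z, ∀ v, JoinedWithin K Sᶜ z v →
      v ∉ compAvoiding G (U ∪ (S ∩ C)) c' := by
    intro z hz v hzv hv
    obtain ⟨x, hx, y, hy, -, hxy, hj⟩ := hzv.exists_exit
      (P := (compAvoiding G (U ∪ (S ∩ C)) c')ᶜ) (fun h => hXC z (hZ hz) (hCsub h))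
      (fun h => h hv)
    replace hj := hj.mono le_rfl Set.inter_subset_left
    rw [Set.notMem_compl_iff] at hy
    have hxatt := mem_attachments_of_adj hy hxy.1.symm hx
    have hxS : x ∉ S := hj.right_mem
    rcases hxatt.1 with hxU | hxD
    · have hxC : x ∉ C := fun h => notMem_of_mem_compAvoiding h hxU
      rcases hR (hxy.2.2.1.resolve_left hxC) with hxY | hxZ
      · exact hS z hz x hxY hj
      · exact hxS (hatt x hxZ hxatt)
    · exact hxS hxD.1
  obtain ⟨a, b, w, ha, hb, hdisj, -, hbS, hw⟩ := hL.exists_trimmed le_rfl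
  have hlast := fun i => exists_isPath_from_last (A := Z) (w i) ⟨_, (w i).start_mem_support, ha i⟩
  choose a' ha' p hp hpw hpZ using hlast
  have hGp : ∀ i x, x ∈ ((p i).mapLe (outerGraph_le G C R)).support ↔ x ∈ (p i).support := by
    intro i x
    simp
  have hwS : ∀ i, ∀ v ∈ (w i).support, v ∈ S → v = b i := fun i v hv hvS =>
    (hw i v hv).resolve_right fun h => h.right_mem hvS
  have hwC : ∀ i, b i ∈ C → ∀ v ∈ (p i).support, v = a' i ∨ v ∈ C := by
    intro i hi v hv
    have hvCR := outerGraph_mem_of_mem_support (w i).reverse (x := v) (.inl hi)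
      (by simpa using hpw i v hv)
    rcases hvCR with hvC | hvR
    · exact .inr hvC
    · rcases hR hvR with hvY | hvZ
      · rcases hw i v (hpw i v hv) with rfl | h
        · exact .inr hi
        · exact (hS _ (ha i) v hvY h).elim
      · exact .inl (hpZ i v hv hvZ)
  refine hM.extend_paths (ι := {i // b i ∈ C}) hc' (fun h => hcS h.1) Set.inter_subset_right hD
    (a := fun i => a' i) (b := fun i => b i)
    (fun i => (p i).mapLe (outerGraph_le G C R)) (fun i => (Walk.isPath_mapLe _).2 (hp i))
    (fun i => hZ (ha' i)) ?_ ?_ ?_ ?_ ?_ ?_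
  · rintro ⟨i, hi⟩ h
    have := hwS i (a' i) (hpw i _ (p i).start_mem_support) (hatt _ (ha' i) h)
    exact hXC _ (hZ (ha' i)) (this ▸ hi)
  · rintro d ⟨hdS, hdC⟩
    obtain ⟨i, rfl⟩ := hbS d hdS
    exact ⟨⟨i, hdC⟩, rfl⟩
  · intro i j v hvi hvj
    by_contra hne
    exact hdisj i j (fun h => hne (Subtype.ext h)) v (hpw _ v ((hGp i v).1 hvi))
      (hpw _ v ((hGp j v).1 hvj))
  · exact fun i v hv => hwC i i.2 v ((hGp i v).1 hv)
  · rintro ⟨i, hi⟩ v hv hvC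
    rcases hw i v (hpw i v ((hGp i v).1 hv)) with rfl | h
    · exact hCS _ hvC (hb i)
    · exact havoid _ (ha i) v h hvC
  · have h₁ : attachments G (U ∪ (S ∩ C)) c' ⊆ (attachments G U c \ (Z \ S)) ∪ (S ∩ C) := by
      intro v hv
      rcases hXsub hv with h | h
      · exact .inl ⟨h, fun hvZ => hvZ.2 (hatt v hvZ.1 hv)⟩
      · exact .inr h
    have h₂ := (Set.ncard_le_ncard h₁).trans (Set.ncard_union_le _ _)
    have h₃ := Set.ncard_sdiff_add_ncard_of_subset
      (show Z \ S ⊆ attachments G U c from Set.sdiff_subset.trans hZ)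
    have h₄ := Set.ncard_inter_add_ncard_sdiff_eq_ncard Z S
    have h₅ : (Z ∩ S).ncard + (S ∩ C).ncard ≤ S.ncard := by
      rw [← Set.ncard_union_eq]
      · exact Set.ncard_le_ncard (Set.union_subset Set.inter_subset_right Set.inter_subset_left)
      · rw [Set.disjoint_left]
        exact fun v hv hv' => hXC v (hZ hv.1) hv'.2
    have h₆ := hM.card_le
    lia

end Premesh

section Mesh

variable {α : Type*} {G H : SimpleGraph α} {U W D : Set α} {c c' : α} {h k : ℕ}

/-- If `S` separates two sets of attachments `Y` and `Z` of the component `C` and misses a connected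
subset `C'` of `C`, then `C'` does not see both `Y \ S` and `Z \ S`. -/
theorem Separates.not_adj_both {C C' Y Z S : Set α} (hS : Separates (outerGraph G C (Y ∪ Z)) Y Z S)
    (hC' : C' ⊆ C) (hC'S : ∀ v ∈ C', v ∉ S) {u v y z : α} (huv : JoinedWithin G C' u v)
    (hy : y ∈ Y) (hyS : y ∉ S) (hz : z ∈ Z) (hzS : z ∉ S) (huy : G.Adj u y) (hvz : G.Adj v z) :
    False := by
  have hu := huv.left_mem
  have hv := huv.right_mem
  refine hS y hy z hz ?_
  have h₁ : (outerGraph G C (Y ∪ Z)).Adj y u :=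
    ⟨huy.symm, .inr (hC' hu), .inr (.inl hy), .inl (hC' hu)⟩
  have h₂ : (outerGraph G C (Y ∪ Z)).Adj v z :=
    ⟨hvz, .inl (hC' hv), .inl (hC' hv), .inr (.inr hz)⟩
  have h₃ : JoinedWithin (outerGraph G C (Y ∪ Z)) C' u v :=
    huv.mono_of_adj fun a ha b hb hab => ⟨hab, .inl (hC' ha), .inl (hC' ha), .inl (hC' hb)⟩
  exact (JoinedWithin.of_adj h₁ hyS (hC'S u hu)).trans
    ((h₃.mono le_rfl hC'S).trans (.of_adj h₂ (hC'S v hv) hzS))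

/-- A minimum separator is completely linked to either side. -/
theorem Separates.linked_of_minimal [Finite α] {K : SimpleGraph α} {Y Z S : Set α}
    (hS : Separates K Y Z S) (hmin : ∀ T, Separates K Y Z T → S.ncard ≤ T.ncard) :
    Linked K Y S S.ncard := by
  refine menger K Y S _ fun T hT => hmin T fun y hy z hz hyz => ?_
  rcases hyz.inter_or_exists_notMem Sᶜ with h | ⟨s, hs, h⟩
  · exact hS y hy z hz h
  · exact hT y hy s (Set.notMem_compl_iff.1 hs) h

theorem IsPremesh.exists_extension [Finite α] (hh : 0 < h) (hk : 0 < k) (hc : c ∉ U)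
    (hM : IsPremesh G h (compAvoiding G U c) (attachments G U c) H W)
    (hno : (attachments G U c).ncard = h → ¬ ∀ Y ⊆ attachments G U c, ∀ Z ⊆ attachments G U c,
      Y.ncard = k → Z.ncard = k → Linked (outerGraph G (compAvoiding G U c) (Y ∪ Z)) Y Z k) :
    ∃ D ⊆ compAvoiding G U c, D.Nonempty ∧ (attachments G U c ∪ D).ncard + 1 ≤ h + k ∧
      ∀ c' ∈ compAvoiding G U c, c' ∉ D → ∃ H' W',
        IsPremesh G h (compAvoiding G (U ∪ D) c') (attachments G (U ∪ D) c') H' W' := by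
  rcases hM.card_le.lt_or_eq with hlt | heq
  · rcases (attachments G U c).eq_empty_or_nonempty with hX | hX
    · refine ⟨{c}, by simpa using mem_compAvoiding_self hc, by simp, ?_, fun c' hc' hne =>
        ⟨_, _, isPremesh_of_attachments_eq_empty hX hh hc' hne hc⟩⟩
      rw [hX, Set.empty_union, Set.ncard_singleton]
      lia
    · obtain ⟨x, hx, hdeg⟩ := hM.exists_leaf hX
      obtain ⟨-, v, hv, hvx⟩ := id hx
      refine ⟨{v}, by simpa using hv, by simp, ?_, fun c' hc' hne =>
        hM.extend_leaf hlt hx hdeg hv hvx hc' hne⟩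
      have := Set.ncard_union_le (attachments G U c) {v}
      rw [Set.ncard_singleton] at this
      lia
  · have hno := hno heq
    push Not at hno
    obtain ⟨Y, hY, Z, hZ, hYk, hZk, hL⟩ := hno
    set C := compAvoiding G U c with hC
    set K := outerGraph G C (Y ∪ Z) with hK
    obtain ⟨S₀, hS₀, hS₀k⟩ : ∃ S, Separates K Y Z S ∧ S.ncard < k := by
      by_contra! hcon
      exact hL (menger K Y Z k hcon)
    obtain ⟨S, hS, hmin⟩ := Set.exists_min_image {S | Separates K Y Z S} Set.ncard
      (Set.toFinite _) ⟨S₀, hS₀⟩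
    have hSk : S.ncard < k := (hmin S₀ hS₀).trans_lt hS₀k
    have hsee : ∀ z ∈ attachments G U c, ∃ v ∈ C, G.Adj v z := fun z hz => hz.2
    have hD : (S ∩ C).Nonempty := by
      rw [Set.nonempty_iff_ne_empty]
      intro hempty
      obtain ⟨y, hy, hyS⟩ := Set.exists_mem_notMem_of_ncard_lt_ncard (hSk.trans_eq hYk.symm)
      obtain ⟨z, hz, hzS⟩ := Set.exists_mem_notMem_of_ncard_lt_ncard (hSk.trans_eq hZk.symm)
      obtain ⟨u, hu, huy⟩ := hsee y (hY hy)
      obtain ⟨v, hv, hvz⟩ := hsee z (hZ hz)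
      exact hS.not_adj_both subset_rfl (fun x hx hxS => by
        have : x ∈ S ∩ C := ⟨hxS, hx⟩
        rwa [hempty] at this) (joinedWithin_compAvoiding hu hv) hy hyS hz hzS huy hvz
    refine ⟨S ∩ C, Set.inter_subset_right, hD, ?_, fun c' hc' hc'D => ?_⟩
    · have h₁ := Set.ncard_union_le (attachments G U c) (S ∩ C)
      have h₂ := Set.ncard_le_ncard (Set.inter_subset_left (s := S) (t := C))
      lia
    · have hc'S : c' ∉ S := fun h => hc'D ⟨h, hc'⟩
      have hCsub : compAvoiding G (U ∪ (S ∩ C)) c' ⊆ C := by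
        rw [hC, ← compAvoiding_eq_of_mem hc']
        exact compAvoiding_union_subset
      have hCS : ∀ v ∈ compAvoiding G (U ∪ (S ∩ C)) c', v ∉ S := fun v hv hvS =>
        notMem_of_mem_compAvoiding hv (.inr ⟨hvS, hCsub hv⟩)
      by_cases hatt : ∀ z ∈ Z, z ∈ attachments G (U ∪ (S ∩ C)) c' → z ∈ S
      · refine hM.extend_side hZ subset_rfl hS.symm
          (hS.symm.linked_of_minimal fun T hT => hmin T hT.symm) (hSk.trans_eq hZk.symm) hD hc'
          hc'S hatt
      · push Not at hatt
        obtain ⟨z, hz, ⟨-, v, hv, hvz⟩, hzS⟩ := hatt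
        refine hM.extend_side hY (Set.union_comm Y Z).subset hS
          (hS.linked_of_minimal hmin) (hSk.trans_eq hYk.symm) hD hc' hc'S ?_
        rintro y hy ⟨-, u, hu, huy⟩
        by_contra hyS
        exact hS.not_adj_both hCsub hCS (joinedWithin_compAvoiding hu hv) hy hyS hz hzS huy hvz

/-- A graph of large treewidth contains a connected subcubic graph attached to a component of its
complement in a highly linked set of `h` vertices. -/
theorem exists_mesh [Finite α] (G : SimpleGraph α) (hh : 0 < h) (hk : 0 < k)
    (htw : h + k ≤ treewidth G + 1) :
    ∃ (C X : Set α) (H : SimpleGraph α) (W : Set α), Disjoint C X ∧ IsPremesh G h C X H W ∧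
      X.ncard = h ∧ ∀ Y ⊆ X, ∀ Z ⊆ X, Y.ncard = k → Z.ncard = k →
        Linked (outerGraph G C (Y ∪ Z)) Y Z k := by
  by_contra hcon
  obtain ⟨n, hn⟩ : ∃ n, h + k = n + 2 := ⟨h + k - 2, by lia⟩
  obtain ⟨U, ⟨hU, hUM⟩, hmax⟩ := (Set.toFinite {U : Set α | PartialDecomp G (n + 1) U ∧
    ∀ c ∉ U, ∃ H W, IsPremesh G h (compAvoiding G U c) (attachments G U c) H W}).exists_maximal
    ⟨∅, PartialDecomp.empty G _, fun c _ => ⟨⊥, ∅, by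
      have hX : attachments G ∅ c = ∅ := by
        ext x
        simp [attachments]
      refine ⟨bot_le, ?_, ?_, ?_, ?_, ?_, ?_, ?_, ?_⟩ <;> simp [hX]⟩⟩
  by_cases huniv : U = Set.univ
  · subst huniv
    have := hU.treewidth_le
    lia
  · obtain ⟨c, hc⟩ := (Set.ne_univ_iff_exists_notMem U).1 huniv
    obtain ⟨H, W, hM⟩ := hUM c hc
    obtain ⟨D, hDC, ⟨d, hd⟩, hcard, hext⟩ := hM.exists_extension hh hk hc fun hX hall =>
      hcon ⟨_, _, H, W, Set.disjoint_left.2 fun x hx hx' => notMem_of_mem_compAvoiding hx hx'.1,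
        hM, hX, hall⟩
    have hDU : ∀ x ∈ D, x ∉ U := fun x hx => notMem_of_mem_compAvoiding (hDC hx)
    refine hDU d hd (hmax (y := U ∪ D) ⟨hU.extend hc hDC (by lia), fun c' hc' => ?_⟩
      Set.subset_union_left (.inr hd))
    have hc'U : c' ∉ U := fun h => hc' (.inl h)
    by_cases hc'C : c' ∈ compAvoiding G U c
    · exact hext c' hc'C fun h => hc' (.inr h)
    · have hdisj : Disjoint (compAvoiding G U c') D := by
        rw [Set.disjoint_left]
        intro x hx hxD
        apply hc'C
        rw [← compAvoiding_eq_of_mem (hDC hxD), compAvoiding_eq_of_mem hx]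
        exact mem_compAvoiding_self hc'U
      rw [compAvoiding_union_eq hdisj, attachments_union_eq hdisj (by ext x; simpa using hDU x)]
      exact hUM c' hc'U

end Mesh

section Cutting

variable {α : Type*} {H : SimpleGraph α} {S X : Set α} {m : ℕ}

/-- Any two vertices of `S` are joined by a walk inside `S`. -/
def IsConnSet (H : SimpleGraph α) (S : Set α) : Prop :=
  ∀ u ∈ S, ∀ v ∈ S, JoinedWithin H S u v

theorem IsConnSet.of_forall {v : α} (h : ∀ u ∈ S, JoinedWithin H S v u) : IsConnSet H S :=
  fun u hu w hw => (h u hu).symm.trans (h w hw)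

theorem isConnSet_setOf_joinedWithin (H : SimpleGraph α) (S : Set α) (w : α) :
    IsConnSet H {x | JoinedWithin H S w x} := by
  refine .of_forall (v := w) ?_
  rintro x ⟨p, hp⟩
  exact ⟨p, fun z hz => JoinedWithin.of_mem_support p hp hz⟩

theorem IsConnSet.exists_cut [Finite α] (hS : IsConnSet H S) (hm : 0 < m)
    (hdeg : ∀ v ∈ S, (H.neighborSet v).ncard ≤ 3)
    (hdegX : ∀ v ∈ X, (H.neighborSet v).ncard ≤ 2) (hcard : m ≤ (X ∩ S).ncard) :
    ∃ P ⊆ S, IsConnSet H P ∧ IsConnSet H (S \ P) ∧ m ≤ (X ∩ P).ncard ∧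
      (X ∩ P).ncard ≤ 2 * m - 1 := by
  obtain ⟨P, ⟨hPS, hP, hSP, hPm⟩, hmin⟩ := Set.exists_min_image
    {P | P ⊆ S ∧ IsConnSet H P ∧ IsConnSet H (S \ P) ∧ m ≤ (X ∩ P).ncard} Set.ncard
    (Set.toFinite _) ⟨S, subset_rfl, hS, by simp [IsConnSet], hcard⟩
  refine ⟨P, hPS, hP, hSP, hPm, ?_⟩
  obtain ⟨x, hxX, hxP⟩ : (X ∩ P).Nonempty := by
    rw [← Set.ncard_pos]
    lia
  obtain ⟨v, hvP, hvdeg, hvconn⟩ : ∃ v ∈ P, (H.neighborSet v ∩ P).ncard ≤ 2 ∧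
      ∀ u ∈ S \ P, JoinedWithin H (insert v (S \ P)) v u := by
    by_cases hne : ∃ y ∈ S, y ∉ P
    · obtain ⟨y, hyS, hyP⟩ := hne
      obtain ⟨v, hv, u, hu, huS, hvu, -⟩ := (hS x (hPS hxP) y hyS).exists_exit hxP hyP
      refine ⟨v, hv, ?_, fun z hz => ?_⟩
      · have h₁ : H.neighborSet v ∩ P ⊆ H.neighborSet v \ {u} := by
          rintro z ⟨hz, hzP⟩
          refine ⟨hz, ?_⟩
          rintro rfl
          exact hu hzP
        have h₂ := Set.ncard_le_ncard h₁
        have h₃ := Set.ncard_sdiff_singleton_lt_of_mem (show u ∈ H.neighborSet v from hvu)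
        have h₄ := hdeg v (hPS hv)
        lia
      · exact (JoinedWithin.of_adj hvu (.inl rfl) (.inr ⟨huS, hu⟩)).trans
          ((hSP u ⟨huS, hu⟩ z hz).mono le_rfl (Set.subset_insert _ _))
    · push Not at hne
      refine ⟨x, hxP, (Set.ncard_le_ncard Set.inter_subset_left).trans (hdegX x hxX), ?_⟩
      rintro z ⟨hzS, hzP⟩
      exact (hzP (hne z hzS)).elim
  let K : α → Set α := fun w => {z | JoinedWithin H (P \ {v}) w z}
  have hKP : ∀ w, K w ⊆ P \ {v} := fun w z hz => hz.right_mem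
  have hcover : ∀ z ∈ P, z ≠ v → ∃ w ∈ H.neighborSet v ∩ P, z ∈ K w := by
    intro z hz hzv
    obtain ⟨a, ha, b, hb, hbP, hab, hj⟩ := (hP z hz v hvP).exists_exit (P := {v}ᶜ) hzv (by simp)
    obtain rfl : b = v := by simpa using hb
    exact ⟨a, ⟨hab.symm, hj.right_mem.1⟩, hj.symm⟩
  have hKcard : ∀ w ∈ H.neighborSet v ∩ P, (X ∩ K w).ncard ≤ m - 1 := by
    rintro w ⟨hvw, hwP⟩
    by_contra! hlt
    have hvK : v ∉ K w := fun h => (hKP w h).2 rfl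
    refine hvK (Set.eq_of_subset_of_ncard_le ((hKP w).trans Set.sdiff_subset)
      (hmin (K w) ⟨((hKP w).trans Set.sdiff_subset).trans hPS,
        isConnSet_setOf_joinedWithin _ _ _, ?_, by lia⟩) ▸ hvP)
    refine .of_forall (v := v) ?_
    have hvS : v ∈ S \ K w := ⟨hPS hvP, hvK⟩
    rintro z ⟨hzS, hzK⟩
    by_cases hzP : z ∈ P
    · by_cases hzv : z = v
      · exact .of_eq hzv.symm hvS
      obtain ⟨w', ⟨hvw', hw'P⟩, hz⟩ := hcover z hzP hzv
      have hsub : K w' ⊆ S \ K w := fun y hy =>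
        ⟨hPS (hKP w' hy).1, fun hy' => hzK (hy'.trans (hy.symm.trans hz))⟩
      have hw'K : w' ∈ K w' := JoinedWithin.refl ⟨hw'P, fun h => hvw'.ne h.symm⟩
      exact (JoinedWithin.of_adj hvw' hvS (hsub hw'K)).trans
        ((isConnSet_setOf_joinedWithin _ _ _ w' hw'K z hz).mono le_rfl hsub)
    · refine (hvconn z ⟨hzS, hzP⟩).mono le_rfl (Set.insert_subset hvS fun y hy => ⟨hy.1, ?_⟩)
      exact fun h => hy.2 (hKP w h).1
  have hfin := Set.toFinite (H.neighborSet v ∩ P)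
  have hsub : X ∩ P ⊆ {v} ∪ ⋃ w ∈ hfin.toFinset, X ∩ K w := by
    rintro z ⟨hzX, hzP⟩
    by_cases hzv : z = v
    · exact .inl hzv
    · obtain ⟨w, hw, hz⟩ := hcover z hzP hzv
      exact .inr (Set.mem_biUnion (hfin.mem_toFinset.2 hw) ⟨hzX, hz⟩)
  have h₁ := (Set.ncard_le_ncard hsub).trans (Set.ncard_union_le _ _)
  have h₂ := Finset.set_ncard_biUnion_le hfin.toFinset fun w => X ∩ K w
  have h₃ : ∑ w ∈ hfin.toFinset, (X ∩ K w).ncard ≤ hfin.toFinset.card * (m - 1) :=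
    Finset.sum_le_card_nsmul _ _ _ fun w hw => hKcard w (hfin.mem_toFinset.1 hw)
  have h₄ : hfin.toFinset.card ≤ 2 := by rwa [← Set.ncard_eq_toFinset_card _ hfin]
  have h₅ := Nat.mul_le_mul_right (m - 1) h₄
  rw [Set.ncard_singleton] at h₁
  lia

theorem IsConnSet.exists_pieces [Finite α] (hm : 0 < m)
    (hdegX : ∀ v ∈ X, (H.neighborSet v).ncard ≤ 2) (n : ℕ) (hS : IsConnSet H S)
    (hdeg : ∀ v ∈ S, (H.neighborSet v).ncard ≤ 3)
    (hcard : n * (2 * m - 1) ≤ (X ∩ S).ncard) :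
    ∃ Q : Fin n → Set α, (∀ i, Q i ⊆ S) ∧ (∀ i, IsConnSet H (Q i)) ∧
      (∀ i, m ≤ (X ∩ Q i).ncard) ∧ Pairwise fun i j => Disjoint (Q i) (Q j) := by
  induction n generalizing S with
  | zero => exact ⟨Fin.elim0, fun i => i.elim0, fun i => i.elim0, fun i => i.elim0,
      fun i => i.elim0⟩
  | succ n ih =>
    rw [add_mul, one_mul] at hcard
    obtain ⟨P, hPS, hP, hSP, hPm, hPm'⟩ := hS.exists_cut hm hdeg hdegX (by lia)
    have hsplit : (X ∩ S).ncard ≤ (X ∩ P).ncard + (X ∩ (S \ P)).ncard := by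
      refine (Set.ncard_le_ncard ?_).trans (Set.ncard_union_le _ _)
      rintro z ⟨hzX, hzS⟩
      by_cases hzP : z ∈ P
      · exact .inl ⟨hzX, hzP⟩
      · exact .inr ⟨hzX, hzS, hzP⟩
    obtain ⟨Q, hQS, hQ, hQm, hQd⟩ := ih hSP (fun v hv => hdeg v hv.1) (by lia)
    have hPQ : ∀ i, Disjoint P (Q i) := fun i =>
      Set.disjoint_left.2 fun x hx hx' => (hQS i hx').2 hx
    refine ⟨Fin.cons P Q, ?_, ?_, ?_, ?_⟩
    · exact Fin.cases hPS fun i => (hQS i).trans Set.sdiff_subset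
    · exact Fin.cases hP hQ
    · exact Fin.cases hPm hQm
    · intro i j hij
      induction i using Fin.cases with
      | zero =>
        induction j using Fin.cases with
        | zero => exact (hij rfl).elim
        | succ j => exact hPQ j
      | succ i =>
        induction j using Fin.cases with
        | zero => exact (hPQ i).symm
        | succ j => exact hQd fun h => hij (congrArg Fin.succ h)

end Cutting

theorem exists_isTree_subgraph {α : Type*} [Finite α] {G H : SimpleGraph α} (hHG : H ≤ G)
    {Q : Set α} (hQ : IsConnSet H Q) (hne : Q.Nonempty) :
    ∃ T : G.Subgraph, T.verts = Q ∧ T.coe.IsTree := by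
  have hconn : (H.induce Q).Connected := induce_connected_iff_joinedWithin.2 ⟨hne, hQ⟩
  obtain ⟨T, hT, hTree⟩ := hconn.exists_isTree_le
  let T' : G.Subgraph :=
    { verts := Q
      Adj := fun x y => ∃ (hx : x ∈ Q) (hy : y ∈ Q), T.Adj ⟨x, hx⟩ ⟨y, hy⟩
      adj_sub := by
        rintro x y ⟨hx, hy, h⟩
        exact hHG (hT h)
      edge_vert := by
        rintro x y ⟨hx, hy, h⟩
        exact hx
      symm := ⟨by
        rintro x y ⟨hx, hy, h⟩
        exact ⟨hy, hx, h.symm⟩⟩ }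
  have hcoe : T'.coe = T := by
    ext x y
    constructor
    · rintro ⟨hx, hy, h⟩
      exact h
    · exact fun h => ⟨x.2, y.2, h⟩
  refine ⟨T', rfl, ?_⟩
  rw [hcoe]
  exact hTree

/-- If `k` items are distributed into rows and into columns with `m` items in each, then there are
`t` cells in distinct rows and columns with at least `q + 1` items each. -/
theorem exists_rich_cells {k p q m : ℕ} (hm : m = 4 * (p + 1) * q + 1)
    (f g : Fin k → Fin (3 * p + 1)) (hf : ∀ l, (Finset.univ.filter fun i => f i = l).card = m)
    (hg : ∀ r, (Finset.univ.filter fun i => g i = r).card = m) (t : ℕ) (ht : t ≤ p + 1) :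
    ∃ l r : Fin t → Fin (3 * p + 1), Function.Injective l ∧ Function.Injective r ∧
      ∀ j, q + 1 ≤ (Finset.univ.filter fun i => f i = l j ∧ g i = r j).card := by
  induction t with
  | zero => exact ⟨Fin.elim0, Fin.elim0, fun i => i.elim0, fun i => i.elim0, fun i => i.elim0⟩
  | succ t ih =>
    obtain ⟨l, r, hl, hr, hlr⟩ := ih (by lia)
    set L := (Finset.univ.image l)ᶜ with hL
    set R := Finset.univ.image r with hR
    have hLc : L.card + t = 3 * p + 1 := by
      have := Finset.card_compl_add_card (Finset.univ.image l)
      rwa [Finset.card_image_of_injective _ hl, Fintype.card_fin, Finset.card_univ,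
        Fintype.card_fin] at this
    have hRc : R.card = t := by
      rw [hR, Finset.card_image_of_injective _ hr, Finset.card_univ, Fintype.card_fin]
    have hRc' : Rᶜ.card + t = 3 * p + 1 := by
      have := Finset.card_compl_add_card R
      rwa [hRc, Fintype.card_fin] at this
    obtain ⟨x, hx, y, hy, hxy⟩ : ∃ x ∈ L, ∃ y ∈ Rᶜ,
        q + 1 ≤ (Finset.univ.filter fun i => f i = x ∧ g i = y).card := by
      by_contra! hcon
      have h₁ : (Finset.univ.filter fun i => f i ∈ L).card = L.card * m := by
        rw [Finset.card_eq_sum_card_fiberwise (f := f) (t := L) fun i hi => by simpa using hi]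
        rw [Finset.sum_const_nat (m := m)]
        intro x hx
        rw [← hf x, Finset.filter_filter]
        congr 1
        ext i
        simp only [Finset.mem_filter, Finset.mem_univ, true_and]
        exact ⟨fun h => h.2, fun h => ⟨h ▸ hx, h⟩⟩
      have h₂ : (Finset.univ.filter fun i => f i ∈ L) ⊆
          (R.biUnion fun y => Finset.univ.filter fun i => g i = y) ∪
          ((L ×ˢ Rᶜ).biUnion fun z => Finset.univ.filter fun i => f i = z.1 ∧ g i = z.2) := by
        intro i hi
        rw [Finset.mem_filter] at hi
        by_cases hgi : g i ∈ R
        · exact Finset.mem_union_left _ (Finset.mem_biUnion.2 ⟨g i, hgi, by simp⟩)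
        · exact Finset.mem_union_right _ (Finset.mem_biUnion.2 ⟨(f i, g i),
            Finset.mk_mem_product hi.2 (Finset.mem_compl.2 hgi), by simp⟩)
      have h₃ := (Finset.card_le_card h₂).trans (Finset.card_union_le _ _)
      have h₄ := Finset.card_biUnion_le_card_mul R
        (fun y => Finset.univ.filter fun i => g i = y) m fun y _ => (hg y).le
      have h₅ := Finset.card_biUnion_le_card_mul (L ×ˢ Rᶜ)
        (fun z => Finset.univ.filter fun i => f i = z.1 ∧ g i = z.2) q fun z hz =>
          Nat.lt_succ_iff.1 (hcon z.1 (Finset.mem_product.1 hz).1 z.2 (Finset.mem_product.1 hz).2)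
      rw [Finset.card_product] at h₅
      rw [hRc] at h₄
      obtain ⟨s, hs⟩ : ∃ s, p = t + s := ⟨p - t, by lia⟩
      have hLs : L.card = 2 * t + 3 * s + 1 := by lia
      have hRs : Rᶜ.card = 2 * t + 3 * s + 1 := by lia
      rw [hLs] at h₁ h₅
      rw [hRs] at h₅
      have h₆ : (2 * t + 3 * s + 1) * m ≤ t * m + (2 * t + 3 * s + 1) * (2 * t + 3 * s + 1) * q := by
        lia
      rw [hm, hs] at h₆
      have h₇ : (t + 3 * s + 1) * (4 * (t + s + 1) * q) + (t + 3 * s + 1) ≤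
          (2 * t + 3 * s + 1) * (2 * t + 3 * s + 1) * q := by
        linarith
      have h₈ : (2 * t + 3 * s + 1) * (2 * t + 3 * s + 1) ≤
          (t + 3 * s + 1) * (4 * (t + s + 1)) := by
        nlinarith
      have h₉ := Nat.mul_le_mul_right q h₈
      rw [mul_assoc] at h₉
      lia
    have hxl : ∀ j, l j ≠ x := fun j hj => by simp [hL] at hx; exact hx j hj
    have hyr : ∀ j, r j ≠ y := fun j hj => by simp [hR] at hy; exact hy j hj
    refine ⟨Fin.cons x l, Fin.cons y r, ?_, ?_, Fin.cases hxy hlr⟩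
    · exact Fin.cons_injective_iff.2 ⟨by rintro ⟨j, hj⟩; exact hxl j hj, hl⟩
    · exact Fin.cons_injective_iff.2 ⟨by rintro ⟨j, hj⟩; exact hyr j hj, hr⟩

/-- A complete linkage in the outer graph gives disjoint paths of length at least two with interior
in `C`. -/
theorem Linked.exists_paths {α : Type*} [Finite α] {G : SimpleGraph α} {C Y Z : Set α} {k : ℕ}
    (h : Linked (outerGraph G C (Y ∪ Z)) Y Z k) (hY : Y.ncard = k) (hZ : Z.ncard = k)
    (hYZ : Disjoint Y Z) (hCY : ∀ y ∈ Y, y ∉ C) (hCZ : ∀ z ∈ Z, z ∉ C) :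
    ∃ (a b : Fin k → α) (p : ∀ i, G.Walk (a i) (b i)), Function.Injective a ∧
      Function.Injective b ∧ Set.range a = Y ∧ Set.range b = Z ∧ (∀ i, (p i).IsPath) ∧
      (∀ i, 2 ≤ (p i).length) ∧
      (Pairwise fun i j => ∀ v, v ∈ (p i).support → v ∉ (p j).support) ∧
      ∀ i, ∀ v ∈ (p i).support.tail.dropLast, v ∈ C := by
  classical
  obtain ⟨a, b, w, ha, hb, hd, hbi, hbs, -⟩ := h.exists_trimmed hZ.le
  have hai : Function.Injective a := by
    intro i j hij
    by_contra hne
    exact hd i j hne (a i) (w i).start_mem_support (by rw [hij]; exact (w j).start_mem_support)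
  have hcard : (Set.range a).ncard = k := by
    rw [← Set.image_univ, Set.ncard_image_of_injective _ hai, Set.ncard_univ, Nat.card_fin]
  have haY : Set.range a = Y :=
    Set.eq_of_subset_of_ncard_le (Set.range_subset_iff.2 ha) (by rw [hcard, hY])
  have hbZ : Set.range b = Z :=
    (Set.range_subset_iff.2 hb).antisymm fun z hz => hbs z hz
  have hsupp : ∀ i v, v ∈ ((w i).bypass.mapLe (outerGraph_le G C (Y ∪ Z))).support →
      v ∈ (w i).support := by
    intro i v hv
    exact (w i).support_bypass_subset_support (by simpa using hv)
  have hpath : ∀ i, ((w i).bypass.mapLe (outerGraph_le G C (Y ∪ Z))).IsPath := fun i =>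
    (Walk.isPath_mapLe _).2 (w i).bypass_isPath
  refine ⟨a, b, fun i => (w i).bypass.mapLe (outerGraph_le G C (Y ∪ Z)), hai, hbi, haY, hbZ,
    hpath, ?_, fun i j hij v hv hv' => hd i j hij v (hsupp i v hv) (hsupp j v hv'), ?_⟩
  · intro i
    rw [Walk.length_mapLe]
    by_contra! hlt
    interval_cases hl : (w i).bypass.length
    · exact Set.disjoint_left.1 hYZ (ha i) (Walk.eq_of_length_eq_zero hl ▸ hb i)
    · have hadj := Walk.adj_of_length_eq_one hl
      exact hadj.2.1.elim (hCY _ (ha i)) (hCZ _ (hb i))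
  · intro i v hv
    set p := (w i).bypass.mapLe (outerGraph_le G C (Y ∪ Z)) with hp
    have hvs : v ∈ p.support.tail := List.mem_of_mem_dropLast hv
    have hvw := hsupp i v (List.mem_of_mem_tail hvs)
    have hva : v ≠ a i := by
      rintro rfl
      have := (hpath i).support_nodup
      rw [← hp, ← Walk.cons_tail_support, List.nodup_cons] at this
      exact this.1 hvs
    have hvb : v ≠ b i := by
      rintro rfl
      have hr := (hpath i).support_nodup
      rw [← hp, ← List.nodup_reverse, ← Walk.support_reverse, ← Walk.cons_tail_support,
        List.nodup_cons] at hr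
      refine hr.1 ?_
      rw [Walk.support_reverse, List.tail_reverse, List.mem_reverse]
      rw [← List.tail_dropLast] at hv
      exact List.mem_of_mem_tail hv
    rcases outerGraph_mem_of_mem_support (w i) (.inr (.inl (ha i))) hvw with h | h | h
    · exact h
    · rw [← haY] at h
      obtain ⟨j, rfl⟩ := h
      by_cases hij : i = j
      · exact (hva (hij ▸ rfl)).elim
      · exact (hd i j hij _ hvw (w j).start_mem_support).elim
    · rw [← hbZ] at h
      obtain ⟨j, rfl⟩ := h
      by_cases hij : i = j
      · exact (hvb (hij ▸ rfl)).elim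
      · exact (hd i j hij _ hvw (w j).end_mem_support).elim

/-- If an injective `a` enumerates the union of the disjoint sets `B i`, then each fibre of the
induced map to the indices has as many elements as `B i`. -/
theorem card_fiber_eq {α : Type*} {n k m : ℕ} {B : Fin n → Set α} {a : Fin k → α}
    (ha : Function.Injective a) (hrange : Set.range a = ⋃ i, B i)
    (hB : Pairwise fun i j => Disjoint (B i) (B j)) (hBm : ∀ i, (B i).ncard = m)
    {f : Fin k → Fin n} (hf : ∀ i, a i ∈ B (f i)) (l : Fin n) :
    (Finset.univ.filter fun i => f i = l).card = m := by
  rw [← hBm l, ← Set.ncard_coe_finset, ← Set.ncard_image_of_injective _ ha]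
  congr 1
  ext x
  constructor
  · rintro ⟨i, hi, rfl⟩
    have hi : f i = l := by simpa using hi
    exact hi ▸ hf i
  · intro hx
    obtain ⟨i, rfl⟩ : x ∈ Set.range a := hrange ▸ Set.mem_iUnion.2 ⟨l, hx⟩
    refine ⟨i, ?_, rfl⟩
    have : f i = l := by
      by_contra hne
      exact Set.disjoint_left.1 (hB hne) (hf i) hx
    simpa using this

theorem mesh_order_le (p q : ℕ) :
    2 * (3 * p + 1) * (2 * (4 * (p + 1) * q + 1) - 1) + (3 * p + 1) * (4 * (p + 1) * q + 1) +
      8 * (p + 1) ^ 2 * (q + 1) ≤ 20 * (p + 1) ^ 2 * (q + 1) ^ 2 + 2 * (q + 1) := by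
  have : 2 * (4 * (p + 1) * q + 1) - 1 = 8 * (p + 1) * q + 1 := by
    rw [Nat.sub_eq_iff_eq_add] <;> lia
  rw [this]
  rcases q with _ | q
  · nlinarith
  · nlinarith [Nat.zero_le (p * q), Nat.zero_le (p ^ 2 * q), Nat.zero_le (p ^ 2 * q ^ 2),
      Nat.zero_le (p * q ^ 2), Nat.zero_le (q ^ 2), Nat.zero_le (p ^ 2)]
/-- If `tw(G) ≥ 20p²q² − 8p²q + 2q − 1` and `degec(G) < 2pq`
(`p, q ≥ 1`), then there are `2p` pairwise disjoint sets `Y_1, Z_1, …, Y_p, Z_p`,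
each of size `q`, connected by pairwise disjoint trees with vertices in a set `A`,
and `pq` pairwise vertex-disjoint paths of length at least `2` such that for each
`i` exactly `q` of the paths go from `Y_i` to `Z_i`, and no internal vertex of any
path lies in `A` or in any of the `2p` sets. -/
theorem mesh_plus {α : Type} [Fintype α] (G : SimpleGraph α) (p q : ℕ)
    (hp : 0 < p) (hq : 0 < q)
    (htw : 20 * p ^ 2 * q ^ 2 - 8 * p ^ 2 * q + 2 * q - 1 ≤ treewidth G)
    (hdegec : contractionDegeneracy G < 2 * p * q) :
    ∃ (Y Z : Fin p → Set α) (A : Set α) (TY TZ : Fin p → G.Subgraph)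
      (P : Fin (p * q) → Σ u : α, Σ v : α, G.Walk u v) (f : Fin (p * q) → Fin p),
      (Pairwise fun i j => Disjoint (Y i) (Y j)) ∧
      (Pairwise fun i j => Disjoint (Z i) (Z j)) ∧
      (∀ i j, Disjoint (Y i) (Z j)) ∧
      (∀ i, (Y i).ncard = q) ∧ (∀ i, (Z i).ncard = q) ∧
      (∀ i, (TY i).coe.IsTree) ∧ (∀ i, (TZ i).coe.IsTree) ∧
      (∀ i, (TY i).verts ⊆ A) ∧ (∀ i, (TZ i).verts ⊆ A) ∧
      (∀ i, Y i ⊆ (TY i).verts) ∧ (∀ i, Z i ⊆ (TZ i).verts) ∧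
      (Pairwise fun i j => Disjoint (TY i).verts (TY j).verts) ∧
      (Pairwise fun i j => Disjoint (TZ i).verts (TZ j).verts) ∧
      (∀ i j, Disjoint (TY i).verts (TZ j).verts) ∧
      (∀ m, (P m).2.2.IsPath) ∧
      (∀ m, 2 ≤ (P m).2.2.length) ∧
      (Pairwise fun m m' => ∀ v, v ∈ (P m).2.2.support → v ∉ (P m').2.2.support) ∧
      (∀ i, (Finset.univ.filter fun m => f m = i).card = q) ∧
      (∀ m, (P m).1 ∈ Y (f m) ∧ (P m).2.1 ∈ Z (f m)) ∧
      (∀ m, ∀ v ∈ (P m).2.2.support.tail.dropLast,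
        v ∉ A ∧ (∀ l, v ∉ Y l) ∧ (∀ l, v ∉ Z l)) := by
  classical
  obtain ⟨p, rfl⟩ : ∃ p', p = p' + 1 := ⟨p - 1, by lia⟩
  obtain ⟨q, rfl⟩ : ∃ q', q = q' + 1 := ⟨q - 1, by lia⟩
  obtain ⟨m, hm⟩ : ∃ m, m = 4 * (p + 1) * q + 1 := ⟨_, rfl⟩
  obtain ⟨N, hN⟩ : ∃ N, N = 3 * p + 1 := ⟨_, rfl⟩
  have horder := mesh_order_le p q
  rw [← hm, ← hN] at horder
  have hm0 : 0 < m := by lia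
  have hN0 : 0 < N := by lia
  have hh : 0 < 2 * N * (2 * m - 1) := by
    have : 0 < 2 * m - 1 := by lia
    positivity
  obtain ⟨C, X, H, W, hCX, hM, hX, hlink⟩ :=
    exists_mesh G (h := 2 * N * (2 * m - 1)) (k := N * m) hh (by positivity) (by lia)
  have hXC : ∀ x ∈ X, x ∉ C := fun x hx hxC => Set.disjoint_left.1 hCX hxC hx
  -- connected pieces of the mesh, each with exactly `m` marked vertices
  have hW : IsConnSet H W := by
    intro u hu v hv
    obtain ⟨w⟩ := hM.reachable u hu v hv
    refine ⟨w, ?_⟩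
    intro x hx
    clear hv
    induction w with
    | nil =>
      obtain rfl : x = _ := by simpa using hx
      exact hu
    | cons h w ih =>
      rw [Walk.support_cons, List.mem_cons] at hx
      rcases hx with rfl | hx
      · exact hu
      · exact ih (hM.mem_of_adj _ _ h.symm) hx
  obtain ⟨Q, hQW, hQ, hQm, hQd⟩ := hW.exists_pieces (X := X) hm0 hM.degree_le_of_mem (N + N)
    (fun v _ => hM.degree_le v) (by
      rw [Set.inter_eq_left.2 hM.subset, hX, two_mul N])
  choose B hBQ hBm using fun i => Set.exists_subset_card_eq (hQm i)
  have hBd : Pairwise fun i j => Disjoint (B i) (B j) := fun i j hij =>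
    (hQd hij).mono ((hBQ i).trans Set.inter_subset_right) ((hBQ j).trans Set.inter_subset_right)
  have hBX : ∀ i, B i ⊆ X := fun i => (hBQ i).trans Set.inter_subset_left
  have hBQ' : ∀ i, B i ⊆ Q i := fun i => (hBQ i).trans Set.inter_subset_right
  have hLR : ∀ i j : Fin N, Fin.castAdd N i ≠ Fin.natAdd N j := fun i j h => by
    have := congrArg Fin.val h
    simp only [Fin.val_castAdd, Fin.val_natAdd] at this
    lia
  have hL : Pairwise fun i j : Fin N => Disjoint (B (Fin.castAdd N i)) (B (Fin.castAdd N j)) :=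
    fun i j hij => hBd fun h => hij (Fin.castAdd_injective N N h)
  have hR : Pairwise fun i j : Fin N => Disjoint (B (Fin.natAdd N i)) (B (Fin.natAdd N j)) :=
    fun i j hij => hBd fun h => hij (Fin.natAdd_injective N N h)
  have hY₀ : (⋃ i, B (Fin.castAdd N i)).ncard = N * m := by
    rw [Set.ncard_iUnion_of_finite (fun _ => Set.toFinite _) hL]
    simp [hBm, finsum_eq_sum_of_fintype]
  have hZ₀ : (⋃ i, B (Fin.natAdd N i)).ncard = N * m := by
    rw [Set.ncard_iUnion_of_finite (fun _ => Set.toFinite _) hR]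
    simp [hBm, finsum_eq_sum_of_fintype]
  -- the linkage and a choice of `p + 1` rich pairs of pieces
  obtain ⟨a, b, w, ha, hb, haY, hbZ, hpath, hlen, hdisj, hint⟩ :=
    (hlink _ (Set.iUnion_subset fun i => hBX _) _ (Set.iUnion_subset fun i => hBX _)
      hY₀ hZ₀).exists_paths hY₀ hZ₀
      (Set.disjoint_iUnion_left.2 fun i => Set.disjoint_iUnion_right.2 fun j => hBd (hLR i j))
      (fun y hy => hXC y (Set.iUnion_subset (fun i => hBX _) hy))
      (fun z hz => hXC z (Set.iUnion_subset (fun i => hBX _) hz))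
  have hfa : ∀ i, ∃ l, a i ∈ B (Fin.castAdd N l) := fun i =>
    Set.mem_iUnion.1 (haY ▸ Set.mem_range_self i)
  have hfb : ∀ i, ∃ r, b i ∈ B (Fin.natAdd N r) := fun i =>
    Set.mem_iUnion.1 (hbZ ▸ Set.mem_range_self i)
  choose f hf using hfa
  choose g hg using hfb
  subst hN
  obtain ⟨l, r, hl, hr, hlr⟩ := exists_rich_cells hm f g (card_fiber_eq ha haY hL (fun _ => hBm _) hf)
    (card_fiber_eq hb hbZ hR (fun _ => hBm _) hg) (p + 1) le_rfl
  choose s hs hsc using fun j => Finset.exists_subset_card_eq (hlr j)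
  let e : ∀ j, Fin (q + 1) ≃ s j := fun j => (Finset.equivFinOfCardEq (hsc j)).symm
  have hef : ∀ j t, f (e j t) = l j ∧ g (e j t) = r j := fun j t => by
    simpa using hs j (e j t).2
  have heinj : ∀ j j' t t', (e j t).1 = (e j' t').1 → j = j' ∧ t = t' := by
    intro j j' t t' h
    obtain rfl : j = j' := hl (by rw [← (hef j t).1, ← (hef j' t').1, h])
    exact ⟨rfl, (e j).injective (Subtype.ext h)⟩
  have hpiece := fun i => exists_isTree_subgraph hM.le (hQ i) (by
    obtain ⟨x, hx⟩ : (X ∩ Q i).Nonempty := by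
      rw [← Set.ncard_pos]
      exact hm0.trans_le (hQm i)
    exact ⟨x, hx.2⟩)
  choose T hTQ hT using hpiece
  have haB : ∀ j t, a (e j t) ∈ B (Fin.castAdd _ (l j)) := fun j t => (hef j t).1 ▸ hf _
  have hbB : ∀ j t, b (e j t) ∈ B (Fin.natAdd _ (r j)) := fun j t => (hef j t).2 ▸ hg _
  have hYB : ∀ j, Set.range (fun t => a (e j t)) ⊆ B (Fin.castAdd _ (l j)) := fun j =>
    Set.range_subset_iff.2 (haB j)
  have hZB : ∀ j, Set.range (fun t => b (e j t)) ⊆ B (Fin.natAdd _ (r j)) := fun j =>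
    Set.range_subset_iff.2 (hbB j)
  have hncard : ∀ c : Fin ((3 * p + 1) * m) → α, Function.Injective c → ∀ j,
      (Set.range fun t => c (e j t).1).ncard = q + 1 := by
    intro c hc j
    rw [← Set.image_univ, Set.ncard_image_of_injective, Set.ncard_univ, Nat.card_fin]
    exact fun t t' h => (heinj j j t t' (hc h)).2
  have hlne : ∀ {i j}, i ≠ j → Fin.castAdd (3 * p + 1) (l i) ≠ Fin.castAdd _ (l j) :=
    fun hij h => hij (hl (Fin.castAdd_injective _ _ h))
  have hrne : ∀ {i j}, i ≠ j → Fin.natAdd (3 * p + 1) (r i) ≠ Fin.natAdd _ (r j) :=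
    fun hij h => hij (hr (Fin.natAdd_injective _ _ h))
  refine ⟨fun j => Set.range fun t => a (e j t), fun j => Set.range fun t => b (e j t), W,
    fun j => T (Fin.castAdd _ (l j)), fun j => T (Fin.natAdd _ (r j)),
    fun i => ⟨_, _, w (e (finProdFinEquiv.symm i).1 (finProdFinEquiv.symm i).2)⟩,
    fun i => (finProdFinEquiv.symm i).1, ?_, ?_, ?_, hncard a ha, hncard b hb, fun j => hT _,
    fun j => hT _, fun j => hTQ _ ▸ hQW _, fun j => hTQ _ ▸ hQW _, ?_, ?_, ?_, ?_, ?_,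
    fun i => hpath _, fun i => hlen _, ?_, ?_, ?_, ?_⟩
  · exact fun i j hij => (hBd (hlne hij)).mono (hYB i) (hYB j)
  · exact fun i j hij => (hBd (hrne hij)).mono (hZB i) (hZB j)
  · exact fun i j => (hBd (hLR _ _)).mono (hYB i) (hZB j)
  · exact fun j => hTQ _ ▸ (hYB j).trans (hBQ' _)
  · exact fun j => hTQ _ ▸ (hZB j).trans (hBQ' _)
  · exact fun i j hij => by simpa only [hTQ] using hQd (hlne hij)
  · exact fun i j hij => by simpa only [hTQ] using hQd (hrne hij)
  · exact fun i j => by simpa only [hTQ] using hQd (hLR _ _)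
  · intro i j hij
    refine hdisj fun h => hij (finProdFinEquiv.symm.injective ?_)
    obtain ⟨h₁, h₂⟩ := heinj _ _ _ _ h
    exact Prod.ext h₁ h₂
  · intro j
    have : (Finset.univ.filter fun i : Fin ((p + 1) * (q + 1)) =>
        (finProdFinEquiv.symm i).1 = j) =
        (Finset.univ.image fun t : Fin (q + 1) => finProdFinEquiv (j, t)) := by
      ext i
      simp only [Finset.mem_filter, Finset.mem_univ, true_and, Finset.mem_image]
      constructor
      · rintro rfl
        exact ⟨(finProdFinEquiv.symm i).2, finProdFinEquiv.apply_symm_apply i⟩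
      · rintro ⟨t, rfl⟩
        simp
    rw [this, Finset.card_image_of_injective, Finset.card_univ, Fintype.card_fin]
    intro t t' h
    simpa using h
  · exact fun i => ⟨⟨_, rfl⟩, ⟨_, rfl⟩⟩
  · intro i v hv
    have hvC := hint _ v hv
    exact ⟨fun h => hM.notMem v h hvC, fun j h => hXC v (hBX _ (hYB j h)) hvC,
      fun j h => hXC v (hBX _ (hZB j h)) hvC⟩
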